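/- arXiv:1107.3205 — 10 statements merged into one kernel-verified Lean document; each statement's English description precedes it below -/
import Mathlib

section
/- Lemma 2.2 (Kolchin). Let f ∈ A be a nonzero differentially homogeneous polynomial of degree d > 0, and let o be the order of f, i.e. the largest k ∈ ℕ such that some variable X(j,k) occurs in f. Then for every index j ∈ Fin (n+1), the formal partial derivative pderiv (X(j,o)) f is differentially homogeneous of degree d − 1. -/
open MvPolynomial

/-- The embedding `ι : F{y_0,…,y_n} → F{t; y_0,…,y_n}`, `X(j,k) ↦ X(Sum.inl j, k)`. -/
noncomputable def iotaMap (F : Type*) [Field F] (n : ℕ) :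
    MvPolynomial (Fin (n + 1) × ℕ) F →ₐ[F] MvPolynomial ((Fin (n + 1) ⊕ Unit) × ℕ) F :=
  aeval fun p => X (Sum.inl p.1, p.2)

/-- The substitution `φ : F{y_0,…,y_n} → F{t; y_0,…,y_n}` sending `X(j,k)` to the expansion
of the `k`-th derivative of `t·y_j`, namely `Σ_{s=0}^{k} (k choose s)·T_s·X(Sum.inl j, k−s)`. -/
noncomputable def phiMap (F : Type*) [Field F] (n : ℕ) :
    MvPolynomial (Fin (n + 1) × ℕ) F →ₐ[F] MvPolynomial ((Fin (n + 1) ⊕ Unit) × ℕ) F :=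
  aeval fun p => ∑ s ∈ Finset.range (p.2 + 1),
    (p.2.choose s : MvPolynomial ((Fin (n + 1) ⊕ Unit) × ℕ) F) *
      X (Sum.inr (), s) * X (Sum.inl p.1, p.2 - s)

/-- `f` is differentially homogeneous of degree `m` : `φ(f) = T_0^m · ι(f)`. -/
def DiffHomog (F : Type*) [Field F] (n m : ℕ)
    (f : MvPolynomial (Fin (n + 1) × ℕ) F) : Prop :=
  phiMap F n f = X (Sum.inr (), 0) ^ m * iotaMap F n f

/-- If the chain rule for the partial derivative of a substitution instance holds on the variables
of `f` with a single common factor `c`, then it holds for `f`. -/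
theorem pderiv_aeval_eq_mul_of_forall_mem_vars {R σ τ : Type*} [CommRing R]
    (g : σ → MvPolynomial τ R) (i : σ) (j : τ) (c : MvPolynomial τ R) {f : MvPolynomial σ R}
    (h : ∀ k ∈ f.vars, pderiv j (g k) = c * aeval g (pderiv i (X k : MvPolynomial σ R))) :
    pderiv j (aeval g f) = c * aeval g (pderiv i f) := by
  let _ : Algebra (MvPolynomial σ R) (MvPolynomial τ R) := (aeval g).toRingHom.toAlgebra
  have : IsScalarTower R (MvPolynomial σ R) (MvPolynomial τ R) :=
    IsScalarTower.of_algebraMap_eq' (aeval g).comp_algebraMap.symm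
  let D₁ : Derivation R (MvPolynomial σ R) (MvPolynomial τ R) :=
    (pderiv j).compAlgebraMap (MvPolynomial σ R)
  let D₂ : Derivation R (MvPolynomial σ R) (MvPolynomial τ R) :=
    (LinearMap.toSpanSingleton (MvPolynomial σ R) (MvPolynomial τ R) c).compDer (pderiv i)
  have hD₂ (p : MvPolynomial σ R) : D₂ p = c * aeval g (pderiv i p) := mul_comm _ _
  have hX : ∀ k ∈ f.vars, D₁ (X k) = D₂ (X k) := fun k hk => by
    rw [hD₂, ← h k hk]
    exact congrArg (pderiv j) (aeval_X g k)
  exact (derivation_eq_of_forall_mem_vars hX).trans (hD₂ f)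

theorem pderiv_iotaMap (F : Type*) [Field F] (n o : ℕ) (j : Fin (n + 1))
    (f : MvPolynomial (Fin (n + 1) × ℕ) F) :
    pderiv (Sum.inl j, o) (iotaMap F n f) = iotaMap F n (pderiv (j, o) f) := by
  refine (pderiv_aeval_eq_mul_of_forall_mem_vars _ (j, o) _ 1 fun p _ => ?_).trans (one_mul _)
  classical
  rw [one_mul, pderiv_X, pderiv_X]
  by_cases hp : p = (j, o)
  · subst hp
    simp
  · rw [Pi.single_eq_of_ne hp, map_zero, Pi.single_eq_of_ne]
    simpa [Prod.ext_iff] using hp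

/-- The highest derivative `y_j^{(o)}` occurs in `φ(f)` only through the terms `t·y_j^{(o)}`. -/
theorem pderiv_phiMap_of_order_le (F : Type*) [Field F] (n o : ℕ) (j : Fin (n + 1))
    {f : MvPolynomial (Fin (n + 1) × ℕ) F} (hf : ∀ p ∈ f.vars, p.2 ≤ o) :
    pderiv (Sum.inl j, o) (phiMap F n f) =
      X (Sum.inr (), 0) * phiMap F n (pderiv (j, o) f) := by
  refine pderiv_aeval_eq_mul_of_forall_mem_vars _ (j, o) _ _ fun p hp => ?_
  classical
  have hterm (s : ℕ) : pderiv (Sum.inl j, o)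
      ((p.2.choose s : MvPolynomial ((Fin (n + 1) ⊕ Unit) × ℕ) F) *
        X (Sum.inr (), s) * X (Sum.inl p.1, p.2 - s)) =
      if p.1 = j ∧ p.2 - s = o then
        (p.2.choose s : MvPolynomial ((Fin (n + 1) ⊕ Unit) × ℕ) F) * X (Sum.inr (), s)
      else 0 := by
    simp [Derivation.leibniz, pderiv_X, Pi.single_apply, Prod.ext_iff]
  rw [map_sum, Finset.sum_congr rfl fun s _ => hterm s, pderiv_X, Pi.single_apply,
    Finset.sum_eq_single 0]
  · by_cases h : p = (j, o)
    · simp [h]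
    · simp [h, ← Prod.mk_inj]
  · intro s hs hs0
    have := hf p hp
    have := Finset.mem_range.mp hs
    exact if_neg fun h => by omega
  · simp

/-- **Lemma 2.2 (Kolchin).** If `f ≠ 0` is differentially homogeneous of degree `d > 0` and
`o` is the order of `f`, then for every `j` the partial derivative `∂f/∂y_j^{(o)}` is
differentially homogeneous of degree `d − 1`. -/
theorem stmt_0 (F : Type*) [Field F] [CharZero F] (n d o : ℕ)
    (f : MvPolynomial (Fin (n + 1) × ℕ) F) (hf : f ≠ 0) (hd : 0 < d)
    (hhom : DiffHomog F n d f)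
    (hord₁ : ∀ (j : Fin (n + 1)) (k : ℕ), (j, k) ∈ f.vars → k ≤ o)
    (hord₂ : ∃ j : Fin (n + 1), (j, o) ∈ f.vars) :
    ∀ j : Fin (n + 1), DiffHomog F n (d - 1) (pderiv (j, o) f) := by
  intro j
  have key := congrArg (pderiv (Sum.inl j, o)) hhom
  have hT : pderiv (Sum.inl j, o)
      ((X (Sum.inr (), 0) : MvPolynomial ((Fin (n + 1) ⊕ Unit) × ℕ) F) ^ d) = 0 := by
    rw [pderiv_pow, pderiv_X_of_ne (by simp), mul_zero]
  rw [pderiv_phiMap_of_order_le F n o j fun p hp => hord₁ p.1 p.2 hp, pderiv_mul, hT, zero_mul,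
    zero_add, pderiv_iotaMap, ← mul_pow_sub_one hd.ne', mul_assoc] at key
  exact mul_left_cancel₀ (X_ne_zero _) key
end

section
/- Theorem 2.3, initial part. Let f ∈ A be differentially homogeneous of degree m, and let i ∈ Fin (n+1) and o ∈ ℕ be such that no variable X(i,k) with k > o occurs in f. Let L be the degree of f in the variable X(i,o) and write f = Σ_{l=0}^{L} I_l · X(i,o)^l with each I_l not involving X(i,o). Then the initial I_L of f (its leading coefficient as a univariate polynomial in X(i,o)) is differentially homogeneous of degree m − L. -/
open MvPolynomial

namespace MvPolynomial

variable {R S σ τ : Type*} [CommSemiring R]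

/-- The coefficients of a polynomial, expanded in powers of one variable, involve only variables
of the polynomial. -/
lemma vars_subset_vars_sum_mul_X_pow (v : σ) (I : ℕ → MvPolynomial σ R)
    (hI : ∀ l, v ∉ (I l).vars) (s : Finset ℕ) {l : ℕ} (hl : l ∈ s) :
    (I l).vars ⊆ (∑ l ∈ s, I l * X v ^ l).vars := by
  classical
  intro x hx
  obtain ⟨d, hd, hxd⟩ := (mem_vars_iff_mem_support _).1 hx
  have hd0 : ∀ k, ∀ e ∈ (I k).support, e v = 0 := fun k e he ↦ by
    by_contra h
    exact hI k ((mem_vars_iff_mem_support _).2 ⟨e, he, Finsupp.mem_support_iff.2 h⟩)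
  refine (mem_vars_iff_mem_support _).2 ⟨d + Finsupp.single v l, ?_, ?_⟩
  · rw [mem_support_iff, coeff_sum, Finset.sum_eq_single l]
    · rw [X_pow_eq_monomial, coeff_mul_monomial, mul_one]
      exact mem_support_iff.1 hd
    · intro k _ hkl
      rw [X_pow_eq_monomial, coeff_mul_monomial', mul_one]
      split_ifs with hle
      · by_contra hne
        have hv := hd0 k _ (mem_support_iff.2 hne)
        have hle' := hle v
        simp [hd0 l d hd] at hv hle'
        omega
      · rfl
    · exact fun h ↦ absurd hl h
  · rw [Finsupp.mem_support_iff] at hxd ⊢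
    simp [hxd]

/-- View a multivariate polynomial as a univariate polynomial in the variable `v`. -/
noncomputable def toPolynomialIn [DecidableEq σ] (R : Type*) [CommSemiring R] (v : σ) :
    MvPolynomial σ R →ₐ[R] Polynomial (MvPolynomial σ R) :=
  aeval fun w ↦ if w = v then Polynomial.X else Polynomial.C (X w)

variable [DecidableEq σ]

@[simp]
lemma toPolynomialIn_X_self (v : σ) : toPolynomialIn R v (X v) = Polynomial.X := by
  simp [toPolynomialIn]

lemma toPolynomialIn_X_of_ne {v w : σ} (h : w ≠ v) :
    toPolynomialIn R v (X w) = Polynomial.C (X w) := by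
  simp [toPolynomialIn, h]

/-- If the images of all variables of `p` under a substitution are constant in `v`, then so is the
image of `p`. -/
lemma toPolynomialIn_algHom_eq_C (v : σ) (g : MvPolynomial τ R →ₐ[R] MvPolynomial σ R)
    {p : MvPolynomial τ R}
    (h : ∀ w ∈ p.vars, toPolynomialIn R v (g (X w)) = Polynomial.C (g (X w))) :
    toPolynomialIn R v (g p) = Polynomial.C (g p) := by
  refine hom_congr_vars (f₁ := ((toPolynomialIn R v).comp g).toRingHom)
    (f₂ := Polynomial.C.comp g.toRingHom) (p₁ := p) (p₂ := p) ?_ (fun w hw _ ↦ h w hw) rfl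
  ext1 a
  have hC : (C a : MvPolynomial τ R) = algebraMap R _ a := rfl
  simp [hC, Polynomial.algebraMap_apply]

end MvPolynomial

/-- The leading coefficient of a polynomial expanded in powers of a linear polynomial. -/
lemma Polynomial.coeff_sum_C_mul_linear_pow {R : Type*} [CommSemiring R] (a : ℕ → R) (b c : R)
    (L : ℕ) :
    (∑ l ∈ Finset.range (L + 1), C (a l) * (C b * X + C c) ^ l).coeff L = a L * b ^ L := by
  have hdeg : (C b * X + C c).natDegree ≤ 1 := natDegree_linear_le
  rw [finsetSum_coeff, Finset.sum_eq_single_of_mem L (by simp)]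
  · have h := coeff_pow_of_natDegree_le (m := L) hdeg
    rw [coeff_C_mul]
    simpa using congrArg (a L * ·) h
  · intro l hl hne
    rw [coeff_C_mul, coeff_eq_zero_of_natDegree_lt, mul_zero]
    have := natDegree_pow_le_of_le l hdeg
    have := Finset.mem_range.1 hl
    omega

section

variable {F : Type*} [Field F] {n : ℕ}

lemma iotaMap_X (p : Fin (n + 1) × ℕ) : iotaMap F n (X p) = X (Sum.inl p.1, p.2) := by
  simp [iotaMap]

lemma phiMap_X (p : Fin (n + 1) × ℕ) : phiMap F n (X p) =
    ∑ s ∈ Finset.range (p.2 + 1), (p.2.choose s : MvPolynomial ((Fin (n + 1) ⊕ Unit) × ℕ) F) *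
      X (Sum.inr (), s) * X (Sum.inl p.1, p.2 - s) := by
  simp [phiMap]

lemma iotaMap_injective : Function.Injective (iotaMap F n) := by
  have h : iotaMap F n = rename fun p ↦ (Sum.inl p.1, p.2) := by
    ext1 p
    simp [iotaMap_X]
  rw [h]
  refine rename_injective _ fun p q hpq ↦ ?_
  simpa [Prod.ext_iff] using hpq

/-- The image of `ι` contains no nonzero multiple of a derivative of `t`. -/
lemma iotaMap_eq_zero_of_X_dvd {p : MvPolynomial (Fin (n + 1) × ℕ) F} (s : ℕ)
    (h : X (Sum.inr (), s) ∣ iotaMap F n p) : p = 0 := by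
  classical
  let g : MvPolynomial ((Fin (n + 1) ⊕ Unit) × ℕ) F →ₐ[F]
      MvPolynomial ((Fin (n + 1) ⊕ Unit) × ℕ) F :=
    aeval fun w ↦ if w = (Sum.inr (), s) then 0 else X w
  have hg : g.comp (iotaMap F n) = iotaMap F n := by
    ext1 q
    simp [g, iotaMap_X]
  obtain ⟨q, hq⟩ := h
  apply iotaMap_injective
  rw [← hg, AlgHom.comp_apply, hq]
  simp [g]

section

variable [DecidableEq ((Fin (n + 1) ⊕ Unit) × ℕ)] (i : Fin (n + 1)) (o : ℕ)

lemma toPolynomialIn_iotaMap {p : MvPolynomial (Fin (n + 1) × ℕ) F} (hp : (i, o) ∉ p.vars) :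
    toPolynomialIn F (Sum.inl i, o) (iotaMap F n p) = Polynomial.C (iotaMap F n p) := by
  refine toPolynomialIn_algHom_eq_C _ _ fun w hw ↦ ?_
  rw [iotaMap_X, toPolynomialIn_X_of_ne]
  intro h
  simp only [Prod.mk.injEq, Sum.inl.injEq] at h
  exact hp (by rwa [← h.1, ← h.2])

lemma toPolynomialIn_phiMap {p : MvPolynomial (Fin (n + 1) × ℕ) F}
    (hp : ∀ k, (i, k) ∈ p.vars → k < o) :
    toPolynomialIn F (Sum.inl i, o) (phiMap F n p) = Polynomial.C (phiMap F n p) := by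
  refine toPolynomialIn_algHom_eq_C _ _ fun ⟨j, k⟩ hw ↦ ?_
  simp only [phiMap_X, map_sum, map_mul, map_natCast]
  refine Finset.sum_congr rfl fun s _ ↦ ?_
  rw [toPolynomialIn_X_of_ne (by simp), toPolynomialIn_X_of_ne]
  simp only [ne_eq, Prod.mk.injEq, Sum.inl.injEq, not_and]
  rintro rfl
  have := hp k hw
  omega

lemma toPolynomialIn_phiMap_X : ∃ c, toPolynomialIn F (Sum.inl i, o) (phiMap F n (X (i, o))) =
    Polynomial.C (X (Sum.inr (), 0)) * Polynomial.X + Polynomial.C c := by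
  refine ⟨∑ s ∈ Finset.range o, (o.choose (s + 1) : MvPolynomial _ F) *
      X (Sum.inr (), s + 1) * X (Sum.inl i, o - (s + 1)), ?_⟩
  rw [phiMap_X, Finset.sum_range_succ', add_comm (Finset.sum _ _)]
  simp only [map_add, map_sum, map_mul, map_natCast]
  refine congrArg₂ (· + ·) ?_ (Finset.sum_congr rfl fun s hs ↦ ?_)
  · simp [toPolynomialIn_X_of_ne]
  · have := Finset.mem_range.1 hs
    rw [toPolynomialIn_X_of_ne (by simp), toPolynomialIn_X_of_ne]
    simp only [ne_eq, Prod.mk.injEq, true_and]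
    omega

end

end

/-- **Theorem 2.3, initial part.** Let `f` be differentially homogeneous of degree `m`, with no
variable `X(i,k)`, `k > o`, occurring in `f`.  Write `f = Σ_{l=0}^{L} I_l · X(i,o)^l` where
`L = degreeOf (i,o) f` and no `I_l` involves `X(i,o)`.  Then the initial `I_L` is
differentially homogeneous of degree `m − L`. -/
theorem stmt_2 (F : Type*) [Field F] [CharZero F] (n m : ℕ) (i : Fin (n + 1)) (o : ℕ)
    (f : MvPolynomial (Fin (n + 1) × ℕ) F)
    (hhom : DiffHomog F n m f)
    (hord : ∀ k : ℕ, (i, k) ∈ f.vars → k ≤ o)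
    (I : ℕ → MvPolynomial (Fin (n + 1) × ℕ) F)
    (hIvars : ∀ l : ℕ, (i, o) ∉ (I l).vars)
    (hdecomp : f = ∑ l ∈ Finset.range (f.degreeOf (i, o) + 1), I l * X (i, o) ^ l) :
    DiffHomog F n (m - f.degreeOf (i, o)) (I (f.degreeOf (i, o))) := by
  classical
  set L := f.degreeOf (i, o)
  have hI {l : ℕ} (hl : l ∈ Finset.range (L + 1)) (k : ℕ) (hk : (i, k) ∈ (I l).vars) : k < o := by
    refine lt_of_le_of_ne (hord k ?_) fun h ↦ hIvars l (h ▸ hk)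
    rw [hdecomp]
    exact vars_subset_vars_sum_mul_X_pow _ I hIvars _ hl hk
  obtain ⟨c, hc⟩ := toPolynomialIn_phiMap_X (F := F) i o
  have hphi : toPolynomialIn F (Sum.inl i, o) (phiMap F n f) =
      ∑ l ∈ Finset.range (L + 1), Polynomial.C (phiMap F n (I l)) *
        (Polynomial.C (X (Sum.inr (), 0)) * Polynomial.X + Polynomial.C c) ^ l := by
    conv_lhs => rw [hdecomp]
    simp only [map_sum, map_mul, map_pow, hc]
    exact Finset.sum_congr rfl fun l hl ↦ by rw [toPolynomialIn_phiMap i o (hI hl)]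
  have hiota : toPolynomialIn F (Sum.inl i, o) (iotaMap F n f) =
      ∑ l ∈ Finset.range (L + 1), Polynomial.C (iotaMap F n (I l)) * Polynomial.X ^ l := by
    conv_lhs => rw [hdecomp]
    simp [toPolynomialIn_iotaMap i o (hIvars _), iotaMap_X]
  have key : phiMap F n (I L) * X (Sum.inr (), 0) ^ L =
      X (Sum.inr (), 0) ^ m * iotaMap F n (I L) := by
    have h := congrArg (fun p ↦ (toPolynomialIn F (Sum.inl i, o) p).coeff L) hhom
    simp only [map_mul, map_pow] at h
    rw [hphi, hiota, toPolynomialIn_X_of_ne (by simp), Polynomial.coeff_sum_C_mul_linear_pow,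
      ← map_pow, Polynomial.coeff_C_mul] at h
    simpa using h
  have hX (k : ℕ) : (X (Sum.inr (), 0) : MvPolynomial ((Fin (n + 1) ⊕ Unit) × ℕ) F) ^ k ≠ 0 :=
    pow_ne_zero _ (X_ne_zero _)
  unfold DiffHomog
  obtain hLm | hLm := le_or_gt L m
  · obtain ⟨k, hk⟩ := Nat.exists_eq_add_of_le hLm
    apply mul_left_cancel₀ (hX L)
    rw [mul_comm, key, hk, Nat.add_sub_cancel_left, pow_add, mul_assoc]
  · obtain ⟨k, hk⟩ := Nat.exists_eq_add_of_lt hLm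
    have hzero : I L = 0 := by
      refine iotaMap_eq_zero_of_X_dvd 0 ⟨phiMap F n (I L) * X (Sum.inr (), 0) ^ k, ?_⟩
      apply mul_left_cancel₀ (hX m)
      rw [← key, hk]
      ring
    simp [hzero]
end

section
/- (One differential indeterminate; used in the proof of Lemma 3.1.) Take n = 0, so that A is the differential polynomial ring F{y} in a single differential indeterminate y, with variables X(0,k) representing y^{(k)}. If f ∈ A is differentially homogeneous of degree m, then f = c · X(0,0)^m, where c ∈ F is the image of f under the evaluation X(0,0) ↦ 1 and X(0,k) ↦ 0 for all k > 0. In particular, every nonzero differentially homogeneous differential polynomial in a single differential indeterminate has order 0, and in fact is a constant multiple of y^m. -/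
open MvPolynomial

/-- The specialization `F{t; y} → F{y}` with `t^{(s)} ↦ y^{(s)}`, `y ↦ 1` and `y^{(k)} ↦ 0` for
`k > 0`. -/
noncomputable def specializeOne (F : Type*) [Field F] :
    MvPolynomial ((Fin (0 + 1) ⊕ Unit) × ℕ) F →ₐ[F] MvPolynomial (Fin (0 + 1) × ℕ) F :=
  aeval fun p => Sum.elim (fun _ => if p.2 = 0 then 1 else 0) (fun _ => X (0, p.2)) p.1

theorem specializeOne_comp_phiMap (F : Type*) [Field F] :
    (specializeOne F).comp (phiMap F 0) = AlgHom.id F _ := by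
  ext1 ⟨j, k⟩
  obtain rfl : j = 0 := Fin.fin_one_eq_zero j
  simp only [AlgHom.comp_apply, phiMap, specializeOne, aeval_X, map_sum, map_mul, map_natCast,
    Sum.elim_inl, Sum.elim_inr, AlgHom.id_apply]
  rw [Finset.sum_range_succ, Finset.sum_eq_zero]
  · simp
  · intro s hs
    have hks : k - s ≠ 0 := Nat.sub_ne_zero_of_lt (Finset.mem_range.mp hs)
    simp [hks]

theorem specializeOne_iotaMap (F : Type*) [Field F] (f : MvPolynomial (Fin (0 + 1) × ℕ) F) :
    specializeOne F (iotaMap F 0 f) = C (eval (fun p => if p.2 = 0 then (1 : F) else 0) f) := by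
  induction f using MvPolynomial.induction_on with
  | C a => simp [iotaMap, specializeOne, algebraMap_eq]
  | add p q hp hq => simp only [map_add, hp, hq]
  | mul_X p i hp =>
    simp only [map_mul, hp]
    simp only [iotaMap, specializeOne, aeval_X, Sum.elim_inl, eval_X]
    split_ifs <;> simp

/-- **One differential indeterminate.** For `n = 0`, every differentially homogeneous
`f ∈ F{y}` of degree `m` equals `c · y^m`, where `c` is the result of evaluating `f` at
`y ↦ 1` and `y^{(k)} ↦ 0` for `k > 0`.  In particular such a nonzero `f` has order `0`. -/
theorem stmt_3 (F : Type*) [Field F] [CharZero F] (m : ℕ)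
    (f : MvPolynomial (Fin 1 × ℕ) F)
    (hhom : DiffHomog F 0 m f) :
    f = C (eval (fun p : Fin 1 × ℕ => if p.2 = 0 then (1 : F) else 0) f) *
        X ((0 : Fin 1), 0) ^ m := by
  have h := congrArg (specializeOne F) hhom
  rw [← AlgHom.comp_apply, specializeOne_comp_phiMap, AlgHom.id_apply, map_mul, map_pow,
    specializeOne_iotaMap, mul_comm] at h
  simpa only [specializeOne, aeval_X, Sum.elim_inr] using h
end

section
/- Lemma 3.1. Let I be a prime differential ideal of A with I ≠ A which is differentially homogeneous, i.e. (i) every f ∈ A satisfying X(j,0)·f ∈ I for all j ∈ Fin (n+1) already lies in I, and (ii) for every P ∈ I, φ(P) lies in the ideal of B generated by ι(I). Then the parametric set of I is nonempty: there exists an index i ∈ Fin (n+1) such that the only element of I lying in the subring F[X(i,k) : k ∈ ℕ] (the differential polynomials involving only y_i and its derivatives) is 0. -/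
open MvPolynomial

/-- If `x 0 ≠ 0`, then the formal derivatives `∑ s ≤ k, (k choose s) T_s x_{k-s}` of the product
`t · x` are algebraically independent. -/
theorem algebraicIndependent_leibniz (F : Type*) {K : Type*} [Field F] [Field K] [Algebra F K]
    (x : ℕ → K) (hx : x 0 ≠ 0) :
    AlgebraicIndependent F (fun k : ℕ => ∑ s ∈ Finset.range (k + 1),
      (k.choose s : MvPolynomial ℕ K) * X s * C (x (k - s))) := by
  -- The substitution is triangular, so a left inverse `X k ↦ h k` is built recursively.
  obtain ⟨h, hh⟩ : ∃ h : ℕ → MvPolynomial ℕ K, ∀ k, h k = C (x 0)⁻¹ *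
      (X k - ∑ s : Fin k, (k.choose s : MvPolynomial ℕ K) * h s * C (x (k - s))) :=
    have hrec (G : ∀ k, (∀ s < k, MvPolynomial ℕ K) → MvPolynomial ℕ K) :
        ∃ h : ℕ → MvPolynomial ℕ K, ∀ k, h k = G k fun s _ => h s :=
      ⟨WellFounded.fix Nat.lt_wfRel.wf G, WellFounded.fix_eq _ G⟩
    hrec fun k h => C (x 0)⁻¹ *
      (X k - ∑ s : Fin k, (k.choose s : MvPolynomial ℕ K) * h s s.2 * C (x (k - s)))
  have hg (k : ℕ) : aeval (R := K) h (∑ s ∈ Finset.range (k + 1),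
      (k.choose s : MvPolynomial ℕ K) * X s * C (x (k - s))) = X k := by
    have hC : (C (x 0)⁻¹ * C (x 0) : MvPolynomial ℕ K) = 1 := by
      rw [← C_mul, inv_mul_cancel₀ hx, C_1]
    have hk := hh k
    rw [Fin.sum_univ_eq_sum_range
      (fun s => (k.choose s : MvPolynomial ℕ K) * h s * C (x (k - s)))] at hk
    simp only [map_sum, map_mul, map_natCast, aeval_X, algHom_C, algebraMap_eq]
    rw [Finset.sum_range_succ, Nat.choose_self, Nat.sub_self, Nat.cast_one, one_mul, hk]
    linear_combination (X k - ∑ s ∈ Finset.range k,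
      (k.choose s : MvPolynomial ℕ K) * h s * C (x (k - s))) * hC
  refine AlgebraicIndependent.of_comp ((aeval (R := K) h).restrictScalars F) ?_
  have hX : ((aeval (R := K) h).restrictScalars F) ∘ (fun k : ℕ => ∑ s ∈ Finset.range (k + 1),
      (k.choose s : MvPolynomial ℕ K) * X s * C (x (k - s))) = X := funext hg
  rw [hX]
  exact (algebraicIndependent_X ℕ K).restrictScalars (algebraMap F K).injective

/-- **Lemma 3.1.** Let `I` be a differentially homogeneous prime differential ideal of
`F{y_0,…,y_n}` with `I ≠ A`.  Then the parametric set of `I` is nonempty: there is an index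
`i` such that the only element of `I` involving only `y_i` and its derivatives is `0`. -/
theorem stmt_4 (F : Type*) [Field F] [CharZero F] (n : ℕ)
    (dF : Derivation ℤ F F)
    (δ : Derivation ℤ (MvPolynomial (Fin (n + 1) × ℕ) F)
      (MvPolynomial (Fin (n + 1) × ℕ) F))
    (hδC : ∀ a : F, δ (C a) = C (dF a))
    (hδX : ∀ (j : Fin (n + 1)) (k : ℕ), δ (X (j, k)) = X (j, k + 1))
    (I : Ideal (MvPolynomial (Fin (n + 1) × ℕ) F))
    (hprime : I.IsPrime) (hne : I ≠ ⊤)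
    (hdiff : ∀ f ∈ I, δ f ∈ I)
    (hsat : ∀ f, (∀ j : Fin (n + 1), X (j, 0) * f ∈ I) → f ∈ I)
    (hhomog : ∀ P ∈ I, phiMap F n P ∈ Ideal.span (iotaMap F n '' (I : Set _))) :
    ∃ i : Fin (n + 1), ∀ f ∈ I, (∀ v ∈ f.vars, v.1 = i) → f = 0 := by
  obtain ⟨i, hi⟩ : ∃ i : Fin (n + 1), X (i, 0) ∉ I := by
    by_contra! hall
    exact hne ((Ideal.eq_top_iff_one I).2 (hsat 1 fun j => by simpa using hall j))
  refine ⟨i, fun f hf hvars => ?_⟩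
  let K := FractionRing (MvPolynomial (Fin (n + 1) × ℕ) F ⧸ I)
  let π : MvPolynomial (Fin (n + 1) × ℕ) F →ₐ[F] K :=
    (IsScalarTower.toAlgHom F (MvPolynomial (Fin (n + 1) × ℕ) F ⧸ I) K).comp
      (Ideal.Quotient.mkₐ F I)
  have hπ (P) : π P = 0 ↔ P ∈ I := by
    change algebraMap (MvPolynomial (Fin (n + 1) × ℕ) F ⧸ I) K (Ideal.Quotient.mk I P) = 0 ↔ _
    rw [FaithfulSMul.algebraMap_eq_zero_iff, Ideal.Quotient.eq_zero_iff_mem]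
  let θ : MvPolynomial ((Fin (n + 1) ⊕ Unit) × ℕ) F →ₐ[F] MvPolynomial ℕ K :=
    aeval fun v => Sum.elim (fun j => C (π (X (j, v.2)))) (fun _ => X v.2) v.1
  have hθι : θ.comp (iotaMap F n) = (IsScalarTower.toAlgHom F K (MvPolynomial ℕ K)).comp π := by
    ext v : 1
    simp [θ, iotaMap, algebraMap_eq]
  have hθI : Ideal.span (iotaMap F n '' (I : Set _)) ≤ RingHom.ker θ := by
    rw [Ideal.span_le]
    rintro _ ⟨P, hP, rfl⟩
    have := DFunLike.congr_fun hθι P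
    simpa [(hπ P).2 hP] using this
  obtain ⟨q, rfl⟩ := exists_rename_eq_of_vars_subset_range f (fun k : ℕ => (i, k))
    (Prod.mk_right_injective i) fun v hv => ⟨v.2, Prod.ext (hvars v hv).symm rfl⟩
  have hq : (θ.comp (phiMap F n)).comp (rename fun k : ℕ => (i, k)) =
      aeval fun k : ℕ => ∑ s ∈ Finset.range (k + 1),
        (k.choose s : MvPolynomial ℕ K) * X s * C (π (X (i, k - s))) := by
    ext k : 1
    simp [θ, phiMap]
  have hq0 : q = 0 := by
    refine (algebraicIndependent_leibniz F (fun k => π (X (i, k)))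
      (mt (hπ _).1 hi)).eq_zero_of_aeval_eq_zero q ?_
    rw [← hq]
    exact hθI (hhomog _ hf)
  rw [hq0, map_zero]
end

section
/- Theorem 3.5 (relation between the differential dimension polynomials of a differentially homogeneous ideal and of its projective variety). Let E be a differential field extension of F with derivation δ extending a ↦ a′, let ξ_1,…,ξ_n ∈ E, and let u ∈ E be differentially transcendental over the differential subfield F⟨ξ_1,…,ξ_n⟩, i.e. the family {δ^k(u) : k ∈ ℕ} is algebraically independent over F({δ^k(ξ_j) : 1 ≤ j ≤ n, k ∈ ℕ}). Then for every t ∈ ℕ, the transcendence degree over F of the subfield F(δ^k(u), δ^k(u·ξ_j) : 0 ≤ k ≤ t, 1 ≤ j ≤ n) of E equals (t + 1) plus the transcendence degree over F of the subfield F(δ^k(ξ_j) : 0 ≤ k ≤ t, 1 ≤ j ≤ n). -/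
open MvPolynomial

/-- The transcendence degree of a field extension `K/F`: the supremum of the cardinalities of
algebraically independent subsets of `K` over `F`. -/
noncomputable def trdeg (F K : Type*) [CommRing F] [CommRing K] [Algebra F K] : Cardinal :=
  ⨆ s : { s : Set K // AlgebraicIndependent F ((↑) : s → K) }, Cardinal.mk s

/-- The general Leibniz rule for the iterates of a derivation. -/
theorem Derivation.iterate_leibniz {R A : Type*} [CommSemiring R] [CommSemiring A] [Algebra R A]
    (D : Derivation R A A) (k : ℕ) (a b : A) :
    D^[k] (a * b) =
      ∑ ij ∈ Finset.HasAntidiagonal.antidiagonal k, k.choose ij.1 • (D^[ij.1] a * D^[ij.2] b) := by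
  induction k with
  | zero => simp
  | succ k ih =>
    rw [Finset.sum_antidiagonal_choose_succ_nsmul (fun i j => D^[i] a * D^[j] b) k]
    simp only [Function.iterate_succ_apply', ih, map_sum, map_nsmul, D.leibniz, smul_eq_mul,
      nsmul_add, Finset.sum_add_distrib]
    congr 1
    refine Finset.sum_congr rfl fun ij hij => ?_
    rw [Nat.choose_symm_of_eq_add (Finset.HasAntidiagonal.mem_antidiagonal.mp hij).symm, mul_comm]

section IterateMem

variable {E S : Type*} [Field E] [SetLike S E] [SubfieldClass S E] (D : Derivation ℤ E E) (L : S)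
  {a b : E} {t : ℕ}

theorem Derivation.iterate_mul_mem (ha : ∀ k ≤ t, D^[k] a ∈ L) (hb : ∀ k ≤ t, D^[k] b ∈ L) :
    ∀ k ≤ t, D^[k] (a * b) ∈ L := by
  intro k hk
  rw [D.iterate_leibniz]
  refine sum_mem fun ij hij => ?_
  have hsum := Finset.HasAntidiagonal.mem_antidiagonal.mp hij
  exact nsmul_mem (mul_mem (ha _ (by lia)) (hb _ (by lia))) _

theorem Derivation.iterate_mem_of_iterate_mul_mem (ha0 : a ≠ 0) (ha : ∀ k ≤ t, D^[k] a ∈ L)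
    (hab : ∀ k ≤ t, D^[k] (a * b) ∈ L) : ∀ k ≤ t, D^[k] b ∈ L := by
  intro k
  induction k using Nat.strong_induction_on with
  | _ k ih =>
    intro hk
    have hmem : (0, k) ∈ Finset.HasAntidiagonal.antidiagonal k := by simp
    have h := D.iterate_leibniz k a b
    rw [← Finset.add_sum_erase _ _ hmem] at h
    simp only [Nat.choose_zero_right, one_smul, Function.iterate_zero, id_eq] at h
    have hmul : a * D^[k] b ∈ L := by
      rw [eq_sub_iff_add_eq.mpr h.symm]
      refine sub_mem (hab k hk) (sum_mem fun ij hij => ?_)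
      obtain ⟨hne, hij⟩ := Finset.mem_erase.mp hij
      have hsum := Finset.HasAntidiagonal.mem_antidiagonal.mp hij
      have hlt : ij.2 < k := by
        by_contra hge
        exact hne (Prod.ext (by simp; omega) (by simp; omega))
      exact nsmul_mem (mul_mem (ha _ (by omega)) (ih _ hlt (by omega))) _
    have h0 : a ∈ L := ha 0 (Nat.zero_le t)
    simpa [ha0] using mul_mem (inv_mem h0) hmul

end IterateMem

open scoped IntermediateField.algebraAdjoinAdjoin in
/-- The field generated by an algebraically independent family has transcendence degree the
cardinality of the family. -/
theorem AlgebraicIndependent.lift_trdeg_adjoin.{v, w} {K : Type*} {E : Type v} {ι : Type w}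
    [Field K] [Field E] [Algebra K E] {x : ι → E} (hx : AlgebraicIndependent K x) :
    Cardinal.lift.{w} (Algebra.trdeg K (IntermediateField.adjoin K (Set.range x))) =
      Cardinal.lift.{v} (Cardinal.mk ι) := by
  have hb : IsTranscendenceBasis K
      (algebraMap (Algebra.adjoin K (Set.range x)) (IntermediateField.adjoin K (Set.range x)) ∘
        hx.aevalEquiv ∘ X) :=
    (hx.aevalEquiv.isTranscendenceBasis (.mvPolynomial ι K)).algebraMap_comp
  exact hb.lift_cardinalMk_eq_trdeg.symm

/-- **Theorem 3.5.** Let `E/F` be a differential field extension, `ξ_1,…,ξ_n ∈ E`, and let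
`u ∈ E` be differentially transcendental over `F⟨ξ_1,…,ξ_n⟩`.  Then for every `t`,
`trdeg F F(δ^k(u), δ^k(u·ξ_j) : k ≤ t, 1 ≤ j ≤ n) = (t+1) + trdeg F F(δ^k(ξ_j) : k ≤ t, j)`. -/
theorem stmt_5 (F E : Type*) [Field F] [CharZero F] [Field E] [Algebra F E]
    (dF : Derivation ℤ F F) (δ : Derivation ℤ E E)
    (hcompat : ∀ a : F, δ (algebraMap F E a) = algebraMap F E (dF a))
    (n : ℕ) (ξ : Fin n → E) (u : E)
    (hu : AlgebraicIndependent
      (IntermediateField.adjoin F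
        (Set.range fun p : Fin n × ℕ => (⇑δ)^[p.2] (ξ p.1)))
      (fun k : ℕ => (⇑δ)^[k] u)) :
    ∀ t : ℕ,
      trdeg F (IntermediateField.adjoin F
        ((Set.range fun k : Fin (t + 1) => (⇑δ)^[(k : ℕ)] u) ∪
         (Set.range fun p : Fin (t + 1) × Fin n => (⇑δ)^[(p.1 : ℕ)] (u * ξ p.2)))) =
      ((t : Cardinal) + 1) +
        trdeg F (IntermediateField.adjoin F
          (Set.range fun p : Fin (t + 1) × Fin n => (⇑δ)^[(p.1 : ℕ)] (ξ p.2))) := by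
  intro t
  change Algebra.trdeg F _ = _ + Algebra.trdeg F _
  set U : Set E := Set.range fun k : Fin (t + 1) => (⇑δ)^[(k : ℕ)] u with hU
  set X : Set E := Set.range fun p : Fin (t + 1) × Fin n => (⇑δ)^[(p.1 : ℕ)] (ξ p.2)
  set Y : Set E := Set.range fun p : Fin (t + 1) × Fin n => (⇑δ)^[(p.1 : ℕ)] (u * ξ p.2)
  have hu0 : u ≠ 0 := hu.ne_zero 0
  have memU {L : IntermediateField F E} : U ⊆ L ↔ ∀ k ≤ t, δ^[k] u ∈ L := by
    simp [hU, Set.range_subset_iff, Fin.forall_iff]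
  have mem_range {L : IntermediateField F E} (η : Fin n → E) :
      (Set.range fun p : Fin (t + 1) × Fin n => (⇑δ)^[(p.1 : ℕ)] (η p.2)) ⊆ L ↔
        ∀ j, ∀ k ≤ t, δ^[k] (η j) ∈ L := by
    rw [Set.range_subset_iff, Prod.forall, forall_comm]
    simp [Fin.forall_iff]
  have memX {L : IntermediateField F E} : X ⊆ L ↔ ∀ j, ∀ k ≤ t, δ^[k] (ξ j) ∈ L :=
    mem_range ξ
  have memY {L : IntermediateField F E} : Y ⊆ L ↔ ∀ j, ∀ k ≤ t, δ^[k] (u * ξ j) ∈ L :=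
    mem_range fun j => u * ξ j
  have hadj : IntermediateField.adjoin F (U ∪ Y) = IntermediateField.adjoin F (X ∪ U) := by
    apply le_antisymm <;> rw [IntermediateField.adjoin_le_iff, Set.union_subset_iff]
    · have h := Set.union_subset_iff.mp (IntermediateField.subset_adjoin F (X ∪ U))
      exact ⟨h.2, memY.mpr fun j => δ.iterate_mul_mem _ (memU.mp h.2) (memX.mp h.1 j)⟩
    · have h := Set.union_subset_iff.mp (IntermediateField.subset_adjoin F (U ∪ Y))
      exact ⟨memX.mpr fun j =>
        δ.iterate_mem_of_iterate_mul_mem _ hu0 (memU.mp h.1) (memY.mp h.2 j), h.1⟩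
  rw [hadj, ← IntermediateField.adjoin_adjoin_left]
  set K := IntermediateField.adjoin F X
  have hle : K ≤ IntermediateField.adjoin F
      (Set.range fun p : Fin n × ℕ => (⇑δ)^[p.2] (ξ p.1)) :=
    IntermediateField.adjoin.mono _ _ _ (Set.range_subset_iff.mpr fun p => ⟨(p.2, p.1), rfl⟩)
  have hind : AlgebraicIndependent K fun k : Fin (t + 1) => (⇑δ)^[(k : ℕ)] u :=
    (hu.comp _ Fin.val_injective).of_ringHom_of_comp_eq (IntermediateField.inclusion hle)
      (RingHom.id E) (IntermediateField.inclusion_injective hle) rfl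
  have hdeg : Algebra.trdeg K (IntermediateField.adjoin K U) = t + 1 := by
    simpa using hind.lift_trdeg_adjoin
  have : FaithfulSMul K (IntermediateField.adjoin K U) :=
    (faithfulSMul_iff_algebraMap_injective _ _).mpr (algebraMap K _).injective
  rw [add_comm, ← hdeg]
  exact (trdeg_add_eq F K (A := IntermediateField.adjoin K U)).symm
end

section
/- (Generic point of the affine cone; proved inside Theorem 3.5.) Let E be a differential field extension of F, let ξ_1,…,ξ_n ∈ E, and let u ∈ E be differentially transcendental over the differential subfield F⟨ξ_1,…,ξ_n⟩. Then for every f ∈ A, the differential evaluation of f at (u, u·ξ_1, …, u·ξ_n) is 0 if and only if f δ-vanishes at (λ, λ·ξ_1, …, λ·ξ_n) for every λ ∈ E. In other words, (u, uξ_1, …, uξ_n) is a generic point of the vanishing ideal of the affine cone over the projective point (1 : ξ_1 : ⋯ : ξ_n). -/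
open MvPolynomial

/-- If all derivatives of `c` lie in the subfield `K`, then `(lam * c)^{(k)}` is a polynomial over `K`
in the derivatives of `lam`, independent of `lam`. -/
theorem exists_aeval_iterate_mul {F E : Type*} [Field F] [Field E] [Algebra F E]
    (δ : Derivation ℤ E E) (K : IntermediateField F E) (k : ℕ) (c : E)
    (hc : ∀ i : ℕ, (⇑δ)^[i] c ∈ K) :
    ∃ g : MvPolynomial ℕ K, ∀ lam : E,
      aeval (fun i : ℕ => (⇑δ)^[i] lam) g = (⇑δ)^[k] (lam * c) := by
  induction k generalizing c with
  | zero =>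
    refine ⟨C ⟨c, hc 0⟩ * X 0, fun lam => ?_⟩
    simp only [map_mul, aeval_C, aeval_X, Function.iterate_zero, id_eq]
    exact mul_comm _ _
  | succ k ih =>
    obtain ⟨g, hg⟩ := ih c hc
    obtain ⟨h, hh⟩ := ih (δ c) fun i => by
      simpa only [Function.iterate_succ_apply] using hc (i + 1)
    refine ⟨rename Nat.succ g + h, fun lam => ?_⟩
    have hδ : (⇑δ)^[k + 1] (lam * c) = (⇑δ)^[k] (δ lam * c) + (⇑δ)^[k] (lam * δ c) := by
      rw [Function.iterate_succ_apply, δ.leibniz, smul_eq_mul, smul_eq_mul, mul_comm c, add_comm]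
      exact iterate_map_add δ k _ _
    rw [map_add, aeval_rename, hh, hδ, ← hg (δ lam)]
    rfl

/-- **Generic point of the affine cone** (proved inside Theorem 3.5).  If `u` is
differentially transcendental over `F⟨ξ_1,…,ξ_n⟩`, then a differential polynomial
`f ∈ F{y_0,…,y_n}` vanishes differentially at `(u, uξ_1, …, uξ_n)` iff it vanishes at
`(λ, λξ_1, …, λξ_n)` for every `λ ∈ E`. -/
theorem stmt_6 (F E : Type*) [Field F] [CharZero F] [Field E] [Algebra F E]
    (dF : Derivation ℤ F F) (δ : Derivation ℤ E E)
    (hcompat : ∀ a : F, δ (algebraMap F E a) = algebraMap F E (dF a))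
    (n : ℕ) (ξ : Fin n → E) (u : E)
    (hu : AlgebraicIndependent
      (IntermediateField.adjoin F
        (Set.range fun p : Fin n × ℕ => (⇑δ)^[p.2] (ξ p.1)))
      (fun k : ℕ => (⇑δ)^[k] u)) :
    ∀ f : MvPolynomial (Fin (n + 1) × ℕ) F,
      aeval (fun p : Fin (n + 1) × ℕ =>
          (⇑δ)^[p.2] ((Fin.cons u fun j : Fin n => u * ξ j : Fin (n+1) → E) p.1)) f = 0 ↔
      ∀ lam : E,
        aeval (fun p : Fin (n + 1) × ℕ =>
          (⇑δ)^[p.2] ((Fin.cons lam fun j : Fin n => lam * ξ j : Fin (n+1) → E) p.1)) f = 0 := by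
  set K := IntermediateField.adjoin F
    (Set.range fun p : Fin n × ℕ => (⇑δ)^[p.2] (ξ p.1))
  have hmem : ∀ (j : Fin (n + 1)) (i : ℕ),
      (⇑δ)^[i] ((Fin.cons 1 ξ : Fin (n + 1) → E) j) ∈ K := by
    intro j i
    refine Fin.cases ?_ (fun j => ?_) j
    · rw [Fin.cons_zero]
      cases i with
      | zero => exact K.one_mem
      | succ i =>
        rw [Function.iterate_succ_apply, δ.map_one_eq_zero, iterate_map_zero]
        exact K.zero_mem
    · rw [Fin.cons_succ]
      exact IntermediateField.subset_adjoin F _ ⟨(j, i), rfl⟩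
  choose g hg using fun p : Fin (n + 1) × ℕ =>
    exists_aeval_iterate_mul δ K p.2 _ (hmem p.1)
  intro f
  have key : ∀ lam : E,
      aeval (fun p : Fin (n + 1) × ℕ =>
        (⇑δ)^[p.2] ((Fin.cons lam fun j : Fin n => lam * ξ j : Fin (n+1) → E) p.1)) f =
      aeval (fun i : ℕ => (⇑δ)^[i] lam) (aeval g f) := by
    intro lam
    have hcone : (fun p : Fin (n + 1) × ℕ =>
        (⇑δ)^[p.2] ((Fin.cons lam fun j : Fin n => lam * ξ j : Fin (n+1) → E) p.1)) =
        fun p => (aeval (R := K) fun i : ℕ => (⇑δ)^[i] lam).restrictScalars F (g p) := by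
      funext p
      rw [AlgHom.restrictScalars_apply, hg p lam]
      congr 1
      refine Fin.cases ?_ (fun j => ?_) p.1 <;> simp
    rw [hcone, ← comp_aeval_apply, AlgHom.restrictScalars_apply]
  refine ⟨fun h lam => ?_, fun h => h u⟩
  rw [key] at h
  rw [key, hu.eq_zero_of_aeval_eq_zero _ h, map_zero]
end

section
/- Theorem 4.7, first part (necessity). Let I be a differential ideal of the differential polynomial ring F{y_0,…,y_n}, regarded inside F{y_0,…,y_n; u_0,…,u_d}, let P_i = Σ_{j=0}^{n} u_{ij}·y_j (0 ≤ i ≤ d), and let v_{ij} ∈ E (0 ≤ i ≤ d, 0 ≤ j ≤ n). Suppose there exists a point a = (a_0,…,a_n) ∈ E^{n+1} with a_{j_0} ≠ 0 for some j_0, such that every element of I δ-vanishes at a and Σ_{j=0}^{n} v_{ij}·a_j = 0 for every i. Then every G in ([I ∪ {P_0,…,P_d}] : (Y)^∞) ∩ F{u_0,…,u_d} (i.e., G lies in the saturation and involves only the u-variables) has differential evaluation 0 at the assignment u_{ij} ↦ v_{ij}. (In the language of the paper: if the d+1 differential hyperplanes with coefficients v_i meet the variety of I, then (v_0,…,v_d)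 is a zero of every element of the ideal sat(F) of the differential Chow form.) -/
open MvPolynomial

/-- The differential ideal `[S]` generated by a set `S`: the ideal generated by all `δ^k(s)`,
`s ∈ S`, `k ∈ ℕ`. -/
noncomputable def diffIdealGen {R : Type*} [CommRing R] (δ : R → R) (S : Set R) : Ideal R :=
  Ideal.span {g | ∃ s ∈ S, ∃ k : ℕ, g = δ^[k] s}

/-- Differential evaluation commutes with the derivations. -/
theorem aeval_iterate_derivation {F E V : Type*} [Field F] [Field E] [Algebra F E]
    (dF : Derivation ℤ F F) (δE : Derivation ℤ E E)
    (hcompat : ∀ a : F, δE (algebraMap F E a) = algebraMap F E (dF a))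
    (δ : Derivation ℤ (MvPolynomial (V × ℕ) F) (MvPolynomial (V × ℕ) F))
    (hδC : ∀ a : F, δ (C a) = C (dF a))
    (hδX : ∀ (w : V) (k : ℕ), δ (X (w, k)) = X (w, k + 1))
    (b : V → E) (f : MvPolynomial (V × ℕ) F) :
    aeval (fun w : V × ℕ => (⇑δE)^[w.2] (b w.1)) (δ f) =
      δE (aeval (fun w : V × ℕ => (⇑δE)^[w.2] (b w.1)) f) := by
  induction f using MvPolynomial.induction_on with
  | C a => rw [hδC, ← algebraMap_eq, AlgHom.commutes, AlgHom.commutes, hcompat]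
  | add p q hp hq => simp only [map_add, hp, hq]
  | mul_X p w hp =>
    obtain ⟨w, k⟩ := w
    simp only [Derivation.leibniz, map_add, map_mul, smul_eq_mul, hp, hδX, aeval_X,
      Function.iterate_succ_apply']

/-- A ring homomorphism commuting with the derivations and killing `S` kills `[S]`. -/
theorem map_eq_zero_of_mem_diffIdealGen {R A : Type*} [CommRing R] [CommRing A]
    (δ : R → R) (δA : Derivation ℤ A A) (φ : R →+* A) (hφ : ∀ f, φ (δ f) = δA (φ f))
    {S : Set R} (hS : ∀ s ∈ S, φ s = 0) {g : R} (hg : g ∈ diffIdealGen δ S) : φ g = 0 := by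
  suffices h : diffIdealGen δ S ≤ RingHom.ker φ from h hg
  refine Ideal.span_le.2 ?_
  rintro _ ⟨s, hs, k, rfl⟩
  change φ (δ^[k] s) = 0
  induction k with
  | zero => exact hS s hs
  | succ k ih => rw [Function.iterate_succ_apply', hφ, ih, map_zero]

/-- **Theorem 4.7, first part (necessity).**  If the `d+1` differential hyperplanes with
coefficients `v_i` meet the variety of `I` (at a point `a` with some `a_{j_0} ≠ 0`), then
every `G` in `([I ∪ {P_0,…,P_d}] : (Y)^∞) ∩ F{u_0,…,u_d}` vanishes differentially at
`u_{ij} ↦ v_{ij}`. -/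
theorem stmt_9 (F E : Type*) [Field F] [CharZero F] [Field E] [Algebra F E]
    (dF : Derivation ℤ F F) (δE : Derivation ℤ E E)
    (hcompat : ∀ a : F, δE (algebraMap F E a) = algebraMap F E (dF a))
    (n d : ℕ)
    (δy : Derivation ℤ (MvPolynomial (Fin (n + 1) × ℕ) F) (MvPolynomial (Fin (n + 1) × ℕ) F))
    (hδyC : ∀ a : F, δy (C a) = C (dF a))
    (hδyX : ∀ (j : Fin (n + 1)) (k : ℕ), δy (X (j, k)) = X (j, k + 1))
    (δ : Derivation ℤ (MvPolynomial ((Fin (n + 1) ⊕ Fin (d + 1) × Fin (n + 1)) × ℕ) F)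
      (MvPolynomial ((Fin (n + 1) ⊕ Fin (d + 1) × Fin (n + 1)) × ℕ) F))
    (hδC : ∀ a : F, δ (C a) = C (dF a))
    (hδX : ∀ (w : Fin (n + 1) ⊕ Fin (d + 1) × Fin (n + 1)) (k : ℕ),
      δ (X (w, k)) = X (w, k + 1))
    (ιy : MvPolynomial (Fin (n + 1) × ℕ) F →ₐ[F]
      MvPolynomial ((Fin (n + 1) ⊕ Fin (d + 1) × Fin (n + 1)) × ℕ) F)
    (hιy : ιy = aeval fun p : Fin (n + 1) × ℕ => X (Sum.inl p.1, p.2))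
    (I : Ideal (MvPolynomial (Fin (n + 1) × ℕ) F))
    (hIdiff : ∀ f ∈ I, δy f ∈ I)
    (P : Fin (d + 1) → MvPolynomial ((Fin (n + 1) ⊕ Fin (d + 1) × Fin (n + 1)) × ℕ) F)
    (hP : ∀ i, P i = ∑ j : Fin (n + 1), X (Sum.inr (i, j), 0) * X (Sum.inl j, 0))
    (v : Fin (d + 1) → Fin (n + 1) → E)
    (a : Fin (n + 1) → E) (j₀ : Fin (n + 1)) (ha : a j₀ ≠ 0)
    (hvanish : ∀ f ∈ I, aeval (fun p : Fin (n + 1) × ℕ => (⇑δE)^[p.2] (a p.1)) f = 0)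
    (hmeet : ∀ i : Fin (d + 1), ∑ j : Fin (n + 1), v i j * a j = 0) :
    ∀ G : MvPolynomial ((Fin (n + 1) ⊕ Fin (d + 1) × Fin (n + 1)) × ℕ) F,
      (∀ j : Fin (n + 1), ∃ e : ℕ,
        X ((Sum.inl j : Fin (n + 1) ⊕ Fin (d + 1) × Fin (n + 1)), 0) ^ e * G ∈
          diffIdealGen (⇑δ) ((ιy '' (I : Set _)) ∪ Set.range P)) →
      (∀ w ∈ G.vars, ∃ q k, w = (Sum.inr q, k)) →
      aeval (fun w : (Fin (n + 1) ⊕ Fin (d + 1) × Fin (n + 1)) × ℕ =>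
        (⇑δE)^[w.2] (Sum.elim a (fun q => v q.1 q.2) w.1)) G = 0 := by
  intro G hG _
  obtain ⟨e, he⟩ := hG j₀
  set φ := aeval (R := F) (fun w : (Fin (n + 1) ⊕ Fin (d + 1) × Fin (n + 1)) × ℕ =>
    (⇑δE)^[w.2] (Sum.elim a (fun q => v q.1 q.2) w.1)) with hφ
  have hS : ∀ s ∈ (ιy '' (I : Set _)) ∪ Set.range P, φ s = 0 := by
    rintro _ (⟨f, hf, rfl⟩ | ⟨i, rfl⟩)
    · rw [← hvanish f hf, hιy, hφ, ← AlgHom.comp_apply, comp_aeval]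
      simp only [aeval_X, Sum.elim_inl]
    · rw [hP, hφ, map_sum, ← hmeet i]
      simp only [map_mul, aeval_X, Sum.elim_inl, Sum.elim_inr, Function.iterate_zero, id_eq]
  have hδ := aeval_iterate_derivation dF δE hcompat δ hδC hδX (Sum.elim a fun q => v q.1 q.2)
  have h : φ _ = 0 := map_eq_zero_of_mem_diffIdealGen (⇑δ) δE (φ : _ →+* E) hδ hS he
  rw [map_mul, map_pow, hφ, aeval_X] at h
  exact (mul_eq_zero.1 h).resolve_left (pow_ne_zero e ha)
end

section
/- (Equation (eq-parderiv) in the proof of Theorem 4.7.) Let ξ_1,…,ξ_n ∈ E and let u_{01},…,u_{0n} ∈ E be differentially independent over the differential subfield F⟨ξ_1,…,ξ_n⟩; set ζ = −Σ_{j=1}^{n} u_{0j}·ξ_j. Let f be an element of the differential polynomial ring F{z_0, z_1, …, z_n} (z_j standing for u_{0j}) and let h ∈ ℕ be such that no variable X(j,k) with k > h occurs in f. If the differential evaluation of f at (z_0,…,z_n) ↦ (ζ, u_{01}, …, u_{0n}) is 0, then for every ρ ∈ {1,…,n}, the differential evaluation of pderiv (X(ρ,h)) f at this same point equals ξ_ρ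 times the differential evaluation of pderiv (X(0,h)) f at this point. -/
open MvPolynomial

/-- The `k`-th derivative of `u_j^{(a)} * ξ^{(b)}`, where `x` lists the derivatives of `ξ` in the
coefficient ring `K`, is a polynomial in the derivatives of `u` of order at most `a + k`, and its
only term of order `a + k` is `ξ^{(b)} * u_j^{(a + k)}`. -/
theorem exists_aeval_eq_iterate_mul {K E ι : Type*} [CommRing K] [CommRing E] [Algebra K E]
    [DecidableEq ι] (δ : Derivation ℤ E E) (u : ι → E) (j : ι) (ξ : E) (x : ℕ → K)
    (hx : ∀ b, algebraMap K E (x b) = (⇑δ)^[b] ξ) (k a b : ℕ) :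
    ∃ P : MvPolynomial (ι × ℕ) K,
      aeval (fun p : ι × ℕ => (⇑δ)^[p.2] (u p.1)) P =
        (⇑δ)^[k] ((⇑δ)^[a] (u j) * (⇑δ)^[b] ξ) ∧
      ∀ (ρ : ι) (h : ℕ), a + k ≤ h →
        pderiv (ρ, h) P = if j = ρ ∧ a + k = h then C (x b) else 0 := by
  induction k generalizing a b with
  | zero =>
    refine ⟨X (j, a) * C (x b), ?_, fun ρ h _ => ?_⟩
    · simp [hx]
    · rw [Derivation.leibniz, pderiv_C, pderiv_X, smul_zero, zero_add, smul_eq_mul]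
      by_cases hjh : j = ρ ∧ a = h
      · obtain ⟨rfl, rfl⟩ := hjh
        simp
      · simp [hjh]
  | succ k ih =>
    obtain ⟨P, hP, hP'⟩ := ih (a + 1) b
    obtain ⟨Q, hQ, hQ'⟩ := ih a (b + 1)
    refine ⟨P + Q, ?_, fun ρ h hh => ?_⟩
    · rw [map_add, hP, hQ, Function.iterate_succ_apply (⇑δ) k, Derivation.leibniz,
        iterate_map_add, Function.iterate_succ_apply' (⇑δ) a, Function.iterate_succ_apply' (⇑δ) b,
        smul_eq_mul, smul_eq_mul, add_comm, mul_comm ((⇑δ)^[b] ξ)]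
    · rw [map_add, hP' ρ h (by omega), hQ' ρ h (by omega),
        if_neg (c := j = ρ ∧ a + k = h) (by omega), add_zero, show a + 1 + k = a + (k + 1) by omega]

/-- Chain rule for a derivation `D` along `aeval g`, for polynomials in the variables of `s`, when
`D ∘ g` takes the value `1` at `v`, `b` at `w` and `0` elsewhere on `s` (the values add up if
`v = w`). -/
theorem derivation_aeval_eq_of_mem_supported {F B τ : Type*} [CommRing F] [CommRing B] [Algebra F B]
    [DecidableEq τ] (D : Derivation F B B) (g : τ → B) (s : Set τ) (v w : τ) (b : B)
    (hD : ∀ t ∈ s, D (g t) =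
      Pi.single (M := fun _ => B) v 1 t + b * Pi.single (M := fun _ => B) w 1 t)
    {f : MvPolynomial τ F} (hf : f ∈ supported F s) :
    D (aeval g f) = aeval g (pderiv v f) + b * aeval g (pderiv w f) := by
  induction hf using Algebra.adjoin_induction with
  | mem p hp =>
    obtain ⟨t, ht, rfl⟩ := hp
    have key : ∀ r : τ, aeval g (pderiv r (X t : MvPolynomial τ F)) =
        Pi.single (M := fun _ => B) r 1 t := fun r => by
      rw [pderiv_X]
      by_cases hr : t = r
      · subst hr
        simp
      · simp [Pi.single_eq_of_ne hr]
    rw [aeval_X, hD t ht, key, key]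
  | algebraMap r => simp [algebraMap_eq]
  | add p q _ _ hp hq =>
    simp only [map_add, hp, hq]
    ring
  | mul p q _ _ hp hq =>
    simp only [map_mul, map_add, Derivation.leibniz, smul_eq_mul, hp, hq]
    ring

/-- **Equation (eq-parderiv) in the proof of Theorem 4.7.**  With `u_{01},…,u_{0n}`
differentially independent over `F⟨ξ⟩` and `ζ = −Σ u_{0j}ξ_j`, if `f(ζ,u_{01},…,u_{0n}) = 0`
and `f` has order at most `h`, then for each `ρ`,
`(∂f/∂z_ρ^{(h)})(ζ,u) = ξ_ρ · (∂f/∂z_0^{(h)})(ζ,u)`. -/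
theorem stmt_10 (F E : Type*) [Field F] [CharZero F] [Field E] [Algebra F E]
    (dF : Derivation ℤ F F) (δE : Derivation ℤ E E)
    (hcompat : ∀ a : F, δE (algebraMap F E a) = algebraMap F E (dF a))
    (n : ℕ) (ξ : Fin n → E) (u : Fin n → E)
    (hu : AlgebraicIndependent
      (IntermediateField.adjoin F (Set.range fun p : Fin n × ℕ => (⇑δE)^[p.2] (ξ p.1)))
      (fun p : Fin n × ℕ => (⇑δE)^[p.2] (u p.1)))
    (ζ : E) (hζ : ζ = -∑ j : Fin n, u j * ξ j)
    (f : MvPolynomial (Fin (n + 1) × ℕ) F) (h : ℕ)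
    (hord : ∀ v ∈ f.vars, v.2 ≤ h)
    (hvan : aeval (fun p : Fin (n + 1) × ℕ =>
      (⇑δE)^[p.2] ((Fin.cons ζ u : Fin (n + 1) → E) p.1)) f = 0) :
    ∀ ρ : Fin n,
      aeval (fun p : Fin (n + 1) × ℕ =>
          (⇑δE)^[p.2] ((Fin.cons ζ u : Fin (n + 1) → E) p.1)) (pderiv (ρ.succ, h) f) =
      ξ ρ * aeval (fun p : Fin (n + 1) × ℕ =>
          (⇑δE)^[p.2] ((Fin.cons ζ u : Fin (n + 1) → E) p.1)) (pderiv ((0 : Fin (n + 1)), h) f) := by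
  classical
  intro ρ
  set K := IntermediateField.adjoin F
    (Set.range fun p : Fin n × ℕ => (⇑δE)^[p.2] (ξ p.1))
  let x : Fin n → ℕ → K := fun j b =>
    ⟨(⇑δE)^[b] (ξ j), IntermediateField.subset_adjoin F _ ⟨(j, b), rfl⟩⟩
  choose P hP hP' using fun (j : Fin n) (k : ℕ) =>
    exists_aeval_eq_iterate_mul δE u j (ξ j) (x j) (fun _ => rfl) k 0 0
  let g : Fin (n + 1) × ℕ → MvPolynomial (Fin n × ℕ) K := fun p =>
    (Fin.cons (-∑ j, P j p.2) (fun j => X (j, p.2)) : Fin (n + 1) → _) p.1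
  have hg : ∀ p : MvPolynomial (Fin (n + 1) × ℕ) F,
      aeval (fun p : Fin n × ℕ => (⇑δE)^[p.2] (u p.1)) (aeval g p) =
        aeval (fun p : Fin (n + 1) × ℕ =>
          (⇑δE)^[p.2] ((Fin.cons ζ u : Fin (n + 1) → E) p.1)) p := by
    intro p
    have : ((aeval (R := K) fun p : Fin n × ℕ => (⇑δE)^[p.2] (u p.1)).restrictScalars F).comp
        (aeval g) = aeval (fun p : Fin (n + 1) × ℕ =>
          (⇑δE)^[p.2] ((Fin.cons ζ u : Fin (n + 1) → E) p.1)) := by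
      ext ⟨i, k⟩
      refine Fin.cases ?_ (fun j => ?_) i
      · simp only [AlgHom.comp_apply, aeval_X, AlgHom.restrictScalars_apply, g, Fin.cons_zero,
          map_neg, map_sum, hP, hζ, iterate_map_neg, Function.iterate_zero, id]
        have hsum := map_sum (δE.toLinearMap ^ k) (fun j => u j * ξ j) Finset.univ
        rw [Module.End.coe_pow] at hsum
        exact congrArg Neg.neg hsum.symm
      · simp [g]
    exact DFunLike.congr_fun this p
  have hzero : aeval g f = 0 :=
    (injective_iff_map_eq_zero _).1 hu _ ((hg f).trans hvan)
  have hsupp : f ∈ supported F {v : Fin (n + 1) × ℕ | v.2 ≤ h} := mem_supported.2 hord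
  have hchain := derivation_aeval_eq_of_mem_supported
    ((pderiv (R := K) (ρ, h)).restrictScalars F) g _ (ρ.succ, h) (0, h) (-C (x ρ 0)) ?_ hsupp
  · rw [hzero, map_zero] at hchain
    have := congrArg (aeval fun p : Fin n × ℕ => (⇑δE)^[p.2] (u p.1)) hchain
    rw [map_zero, map_add, map_mul, hg, hg, map_neg, aeval_C] at this
    have hx : algebraMap K E (x ρ 0) = ξ ρ := rfl
    rw [hx] at this
    linear_combination -this
  · rintro ⟨i, k⟩ hk
    simp only [Set.mem_ofPred_eq] at hk
    refine Fin.cases ?_ (fun j => ?_) i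
    · have h0 : ((0 : Fin (n + 1)), k) ≠ (ρ.succ, h) := fun e =>
        (Fin.succ_ne_zero ρ) (Prod.mk.inj e).1.symm
      rw [Pi.single_eq_of_ne h0, zero_add]
      simp only [Derivation.restrictScalars_apply, g, Fin.cons_zero, map_neg, map_sum]
      rw [Finset.sum_congr rfl fun j _ => hP' j k ρ h (by omega)]
      by_cases hkh : k = h
      · subst hkh
        simp
      · simp [hkh]
    · have h0 : (j.succ, k) ≠ ((0 : Fin (n + 1)), h) := fun e =>
        (Fin.succ_ne_zero j) (Prod.mk.inj e).1
      rw [Pi.single_eq_of_ne h0, mul_zero, add_zero]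
      simp only [Derivation.restrictScalars_apply, g, Fin.cons_succ, pderiv_X]
      by_cases hjk : j = ρ ∧ k = h
      · obtain ⟨rfl, rfl⟩ := hjk
        simp
      · have h1 : (j, k) ≠ (ρ, h) := fun e => hjk (Prod.mk.inj e)
        have h2 : (j.succ, k) ≠ (ρ.succ, h) := fun e =>
          hjk ⟨Fin.succ_injective _ (Prod.mk.inj e).1, (Prod.mk.inj e).2⟩
        rw [Pi.single_eq_of_ne h2, Pi.single_eq_of_ne h1]
end

section
/- (Key step of the proof of Theorem 4.7, second part.) Assume the setting of Theorem 4.2: ξ_1,…,ξ_n ∈ E, the u_{ij} ∈ E (0 ≤ i ≤ d, 1 ≤ j ≤ n) differentially independent over F⟨ξ_1,…,ξ_n⟩, ζ_i = −Σ_{j=1}^{n} u_{ij}ξ_j, I the ideal of differential polynomials in the y-variables that δ-vanish at (λ, λξ_1,…,λξ_n) for all λ ∈ E, P_i = Σ_{j=0}^{n} u_{ij}y_j, and J = [I ∪ {P_0,…,P_d}] : (Y)^∞. Let f ∈ F{u_0,…,u_d} (involving only u-variables) be such that its differential evaluation at u_{i0} ↦ ζ_i, u_{ij} ↦ u_{ij}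 is 0, and let h ∈ ℕ be such that no variable X(u_{0j}, k) with k > h occurs in f. Set S_f = pderiv (X(u_{00}, h)) f. Then for every ρ ∈ {1,…,n}, the differential polynomial A_ρ = S_f · y_ρ − (pderiv (X(u_{0ρ}, h)) f) · y_0 belongs to J. -/
open MvPolynomial

section CoefficientKernel

variable {R A σ τ : Type*} [CommRing R] [CommRing A] [Algebra R A]

theorem MvPolynomial.mem_map_rename_inr_ker (φ : MvPolynomial τ R →ₐ[R] A)
    {p : MvPolynomial (σ ⊕ τ) R} (hp : map (φ : MvPolynomial τ R →+* A) (sumAlgEquiv R σ τ p) = 0) :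
    p ∈ (RingHom.ker φ).map (rename Sum.inr : MvPolynomial τ R →ₐ[R] MvPolynomial (σ ⊕ τ) R) := by
  have h1 : sumAlgEquiv R σ τ p ∈ (RingHom.ker φ).map (C : _ →+* MvPolynomial σ _) := by
    rw [mem_map_C_iff]
    intro m
    have := congrArg (coeff m) hp
    simpa [coeff_map] using this
  have h2 := Ideal.mem_map_of_mem (sumAlgEquiv R σ τ).symm h1
  rw [AlgEquiv.symm_apply_apply] at h2
  refine (Ideal.map_le_iff_le_comap.2 (Ideal.map_le_iff_le_comap.2 fun c hc => ?_)) h2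
  have h3 : (sumAlgEquiv R σ τ).symm (C c) = rename Sum.inr c := by
    rw [AlgEquiv.symm_apply_eq]
    exact (DFunLike.congr_fun (sumAlgEquiv_comp_rename_inr R σ τ) c).symm
  simp only [Ideal.mem_comap]
  rw [h3]
  exact Ideal.mem_map_of_mem _ hc

end CoefficientKernel

/-- An additive map satisfying the Leibniz rule, as a derivation over `ℤ`. -/
def Derivation.ofAddMonoidHom {A : Type*} [CommRing A] [Algebra ℤ A] (D : A →+ A)
    (hD : ∀ a b, D (a * b) = a * D b + b * D a) : Derivation ℤ A A where
  toFun := D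
  map_add' := map_add D
  map_smul' a p := by
    rw [Algebra.smul_def, eq_intCast, ← zsmul_eq_mul]
    exact map_zsmul D a p
  map_one_eq_zero' := by
    have h := hD 1 1
    rw [one_mul, one_mul, left_eq_add] at h
    exact h
  leibniz' := hD

section Prolongation

variable {R : Type*} [CommRing R] [Algebra ℤ R] (σ : Type*)

theorem MvPolynomial.coeff_sum_monomial_derivation {σ : Type*} (d : Derivation ℤ R R)
    (p : MvPolynomial σ R) (m : σ →₀ ℕ) :
    coeff m (∑ m ∈ p.support, monomial m (d (coeff m p))) = d (coeff m p) := by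
  classical
  simp only [coeff_sum, coeff_monomial]
  rw [Finset.sum_ite_eq']
  split_ifs with h
  · rfl
  · rw [notMem_support_iff.1 h, map_zero]

/-- The derivation of a polynomial ring applying `d` to the coefficients and killing the
variables. -/
noncomputable def MvPolynomial.coeffDerivation (d : Derivation ℤ R R) :
    Derivation ℤ (MvPolynomial σ R) (MvPolynomial σ R) :=
  let D : MvPolynomial σ R →+ MvPolynomial σ R :=
    { toFun := fun p => ∑ m ∈ p.support, monomial m (d (coeff m p))
      map_zero' := by simp
      map_add' := fun p q => by
        ext m
        rw [coeff_add]
        iterate 3 rw [coeff_sum_monomial_derivation]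
        rw [coeff_add, map_add] }
  have hD (p : MvPolynomial σ R) (m) : coeff m (D p) = d (coeff m p) :=
    coeff_sum_monomial_derivation d p m
  Derivation.ofAddMonoidHom D fun p q => by
      classical
      ext m
      rw [hD, coeff_add, mul_comm q, coeff_mul, coeff_mul, coeff_mul]
      simp_rw [hD]
      rw [map_sum, ← Finset.sum_add_distrib]
      refine Finset.sum_congr rfl fun x _ => ?_
      rw [Derivation.leibniz, smul_eq_mul, smul_eq_mul, mul_comm (d _)]

theorem MvPolynomial.coeff_coeffDerivation (d : Derivation ℤ R R) (p : MvPolynomial σ R)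
    (m : σ →₀ ℕ) : coeff m (coeffDerivation σ d p) = d (coeff m p) :=
  coeff_sum_monomial_derivation d p m

/-- The derivation of the differential polynomial ring `R{σ}` extending `d`. -/
noncomputable def MvPolynomial.prolong (d : Derivation ℤ R R) :
    Derivation ℤ (MvPolynomial (σ × ℕ) R) (MvPolynomial (σ × ℕ) R) :=
  coeffDerivation (σ × ℕ) d +
    Derivation.ofAddMonoidHom
      (mkDerivation R fun v : σ × ℕ => (X (v.1, v.2 + 1) : MvPolynomial (σ × ℕ) R)).toAddMonoidHom
      (fun p q => (mkDerivation R _).leibniz p q)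

variable {σ}

theorem MvPolynomial.prolong_apply (d : Derivation ℤ R R) (p : MvPolynomial (σ × ℕ) R) :
    prolong σ d p = coeffDerivation (σ × ℕ) d p +
      mkDerivation R (fun v : σ × ℕ => (X (v.1, v.2 + 1) : MvPolynomial (σ × ℕ) R)) p := rfl

@[simp]
theorem MvPolynomial.prolong_C (d : Derivation ℤ R R) (a : R) :
    prolong σ d (C a) = C (d a) := by
  classical
  have : coeffDerivation (σ × ℕ) d (C a) = C (d a) := by
    ext m
    rw [coeff_coeffDerivation, coeff_C, coeff_C]
    split_ifs <;> simp
  rw [prolong_apply, this, derivation_C, add_zero]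

@[simp]
theorem MvPolynomial.prolong_X (d : Derivation ℤ R R) (v : σ × ℕ) :
    prolong σ d (X v) = X (v.1, v.2 + 1) := by
  classical
  have : coeffDerivation (σ × ℕ) d (X v) = 0 := by
    ext m
    rw [coeff_coeffDerivation, coeff_X]
    split_ifs <;> simp
  rw [prolong_apply, this, mkDerivation_X, zero_add]

end Prolongation

section DiffEval

variable {R A σ : Type*} [CommRing R] [CommRing A] [Algebra R A]

/-- The differential evaluation of differential polynomials at `b`. -/
noncomputable def MvPolynomial.diffAeval (dA : A → A) (b : σ → A) :
    MvPolynomial (σ × ℕ) R →ₐ[R] A :=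
  aeval fun v => dA^[v.2] (b v.1)

theorem MvPolynomial.diffAeval_X (dA : A → A) (b : σ → A) (v : σ × ℕ) :
    diffAeval (R := R) dA b (X v) = dA^[v.2] (b v.1) := by
  simp [diffAeval]

theorem MvPolynomial.diffAeval_derivation [Algebra ℤ R] [Algebra ℤ A] {d : Derivation ℤ R R}
    {dA : Derivation ℤ A A}
    (hd : ∀ a, dA (algebraMap R A a) = algebraMap R A (d a)) (b : σ → A)
    {δ : Derivation ℤ (MvPolynomial (σ × ℕ) R) (MvPolynomial (σ × ℕ) R)}
    (hδC : ∀ a, δ (C a) = C (d a)) (hδX : ∀ v k, δ (X (v, k)) = X (v, k + 1))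
    (p : MvPolynomial (σ × ℕ) R) :
    diffAeval dA b (δ p) = dA (diffAeval dA b p) := by
  induction p using MvPolynomial.induction_on with
  | C a => rw [hδC, ← algebraMap_eq, AlgHom.commutes, AlgHom.commutes, hd]
  | add p q hp hq => simp [hp, hq]
  | mul_X p v hp =>
    obtain ⟨v, k⟩ := v
    simp [hp, hδX, diffAeval_X, Function.iterate_succ_apply']

end DiffEval

theorem Function.Semiconj.iterate_apply {α β : Type*} {f : α → β} {ga : α → α} {gb : β → β}
    (h : Function.Semiconj f ga gb) (k : ℕ) (x : α) : f (ga^[k] x) = gb^[k] (f x) :=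
  h.iterate_right k x

section Saturation

variable {k R : Type*} [CommRing k] [CommRing R] [Algebra k R]

theorem derivation_mem_diffIdealGen [Algebra ℤ R] (δ : Derivation ℤ R R) {S : Set R} {x : R}
    (hx : x ∈ diffIdealGen δ S) : δ x ∈ diffIdealGen δ S := by
  induction hx using Submodule.span_induction with
  | mem x hx =>
    obtain ⟨s, hs, k, rfl⟩ := hx
    exact Ideal.subset_span ⟨s, hs, k + 1, (Function.iterate_succ_apply' _ _ _).symm⟩
  | zero => simp
  | add x y _ _ hx hy => rw [map_add]; exact add_mem hx hy
  | smul a x hx' hx =>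
    rw [smul_eq_mul, Derivation.leibniz, smul_eq_mul, smul_eq_mul]
    exact add_mem (Ideal.mul_mem_left _ _ hx) (Ideal.mul_mem_right _ _ hx')

theorem subset_diffIdealGen (δ : R → R) (S : Set R) : S ⊆ diffIdealGen δ S :=
  fun s hs => Ideal.subset_span ⟨s, hs, 0, rfl⟩

/-- The elements which, up to a power of `y`, are congruent modulo `K` to an element of `G`. -/
def reducibleModulo (G : Subalgebra k R) (y : R) (hy : y ∈ G) (K : Ideal R) : Subalgebra k R where
  carrier := {g | ∃ e : ℕ, ∃ g' ∈ G, y ^ e * g - g' ∈ K}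
  algebraMap_mem' a := ⟨0, _, G.algebraMap_mem a, by simp⟩
  add_mem' := by
    rintro a b ⟨e, a', ha', ha⟩ ⟨f, b', hb', hb⟩
    refine ⟨e + f, y ^ f * a' + y ^ e * b', add_mem (mul_mem (pow_mem hy _) ha')
      (mul_mem (pow_mem hy _) hb'), ?_⟩
    have : y ^ (e + f) * (a + b) - (y ^ f * a' + y ^ e * b') =
      y ^ f * (y ^ e * a - a') + y ^ e * (y ^ f * b - b') := by ring
    rw [this]
    exact add_mem (K.mul_mem_left _ ha) (K.mul_mem_left _ hb)
  mul_mem' := by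
    rintro a b ⟨e, a', ha', ha⟩ ⟨f, b', hb', hb⟩
    refine ⟨e + f, a' * b', mul_mem ha' hb', ?_⟩
    have : y ^ (e + f) * (a * b) - a' * b' =
      (y ^ f * b) * (y ^ e * a - a') + a' * (y ^ f * b - b') := by ring
    rw [this]
    exact add_mem (K.mul_mem_left _ ha) (K.mul_mem_left _ hb)

theorem mem_reducibleModulo {G : Subalgebra k R} {y : R} {hy : y ∈ G} {K : Ideal R} {g : R} :
    g ∈ reducibleModulo G y hy K ↔ ∃ e : ℕ, ∃ g' ∈ G, y ^ e * g - g' ∈ K := Iff.rfl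

theorem le_reducibleModulo {G : Subalgebra k R} {y : R} {hy : y ∈ G} {K : Ideal R} :
    G ≤ reducibleModulo G y hy K := fun g hg => ⟨0, g, hg, by simp⟩

theorem mem_reducibleModulo_of_mul_add_mem {G : Subalgebra k R} {y : R} {hy : y ∈ G} {K : Ideal R}
    {g r : R} (hr : r ∈ G) (h : g * y + r ∈ K) : g ∈ reducibleModulo G y hy K :=
  ⟨1, -r, neg_mem hr, by rwa [pow_one, sub_neg_eq_add, mul_comm]⟩

theorem derivation_mem_reducibleModulo [Algebra ℤ R] {G : Subalgebra k R} {y : R} {hy : y ∈ G}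
    {K : Ideal R} {δ : Derivation ℤ R R} (hG : ∀ g ∈ G, δ g ∈ G) (hK : ∀ g ∈ K, δ g ∈ K) {g : R}
    (hg : g ∈ reducibleModulo G y hy K) : δ g ∈ reducibleModulo G y hy K := by
  obtain ⟨e, g', hg', h⟩ := hg
  refine ⟨e + 1, y * δ g' - (e : R) * δ y * g', sub_mem (mul_mem hy (hG _ hg'))
    (mul_mem (mul_mem (natCast_mem G e) (hG _ hy)) hg'), ?_⟩
  have h1 : y * δ (y ^ e * g - g') - (e : R) * δ y * (y ^ e * g - g') =
      y ^ (e + 1) * δ g - (y * δ g' - (e : R) * δ y * g') := by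
    rw [map_sub, Derivation.leibniz, Derivation.leibniz_pow]
    rcases e with _ | e
    · simp [mul_sub]
    · simp only [smul_eq_mul, nsmul_eq_mul, Nat.add_sub_cancel]
      ring
  rw [← h1]
  exact sub_mem (K.mul_mem_left _ (hK _ h)) (K.mul_mem_left _ h)

end Saturation

theorem derivation_mem_supported {R σ : Type*} [CommRing R] [Algebra ℤ R] {d : Derivation ℤ R R}
    {δ : Derivation ℤ (MvPolynomial σ R) (MvPolynomial σ R)} {s t : Set σ} (hst : s ⊆ t)
    (hδC : ∀ a, δ (C a) = C (d a)) (hδX : ∀ v ∈ s, δ (X v) ∈ supported R t)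
    {p : MvPolynomial σ R} (hp : p ∈ supported R s) : δ p ∈ supported R t := by
  have hle := supported_mono (R := R) hst
  induction hp using Algebra.adjoin_induction with
  | mem _ hv => obtain ⟨v, hv, rfl⟩ := hv; exact hδX v hv
  | algebraMap a => rw [algebraMap_eq, hδC, ← algebraMap_eq]; exact Subalgebra.algebraMap_mem _ _
  | add p q _ _ hp hq => rw [map_add]; exact add_mem hp hq
  | mul p q hp' hq' hp hq =>
    rw [Derivation.leibniz, smul_eq_mul, smul_eq_mul]
    exact add_mem (mul_mem (hle hp') hq) (mul_mem (hle hq') hp)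

theorem prolong_iterate_C {R σ : Type*} [CommRing R] [Algebra ℤ R] (d : Derivation ℤ R R) (k : ℕ)
    (a : R) :
    (prolong σ d)^[k] (C a) = C (d^[k] a) :=
  (Function.Semiconj.iterate_apply (fun a => (prolong_C d a).symm) k a).symm

theorem prolong_iterate_X {R σ : Type*} [CommRing R] [Algebra ℤ R] (d : Derivation ℤ R R) (k : ℕ)
    (v : σ) :
    (prolong σ d)^[k] (X (v, 0)) = X (v, k) := by
  induction k with
  | zero => rfl
  | succ k ih => rw [Function.iterate_succ_apply', ih, prolong_X]

section GenericPoint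

variable {F E ι κ : Type*} [Field F] [Field E] [Algebra F E]

/-- The variables other than the derivatives of the `u i j`. -/
def freeVars (κ : Type*) (j : ι) : Set ((ι ⊕ κ × ι) × ℕ) := {v | ∀ i, v.1 ≠ Sum.inr (i, j)}

theorem X_inl_mem_supported_freeVars (j l : ι) (k : ℕ) :
    (X (Sum.inl l, k) : MvPolynomial ((ι ⊕ κ × ι) × ℕ) F) ∈ supported F (freeVars κ j) :=
  Algebra.subset_adjoin ⟨_, fun _ => Sum.inl_ne_inr, rfl⟩

theorem X_inr_mem_supported_freeVars {j : ι} {q : κ × ι} (hq : q.2 ≠ j) (k : ℕ) :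
    (X (Sum.inr q, k) : MvPolynomial ((ι ⊕ κ × ι) × ℕ) F) ∈ supported F (freeVars κ j) :=
  Algebra.subset_adjoin ⟨(Sum.inr q, k), fun i h => hq (by cases h; rfl), rfl⟩

/-- The differential polynomial ring `E{Λ}{u}` over `E`. -/
abbrev GenericRing (E ι κ : Type*) [Field E] : Type _ :=
  MvPolynomial ((κ × ι) × ℕ) (MvPolynomial (Unit × ℕ) E)

/-- The derivation of `E{Λ}{u}`. -/
noncomputable abbrev genericDerivation (ι κ : Type*) (δE : Derivation ℤ E E) :
    Derivation ℤ (GenericRing E ι κ) (GenericRing E ι κ) :=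
  prolong (κ × ι) (prolong Unit δE)

/-- The specialization `Λ ↦ 1`, `u ↦ w` of `E{Λ}{u}`. -/
noncomputable def specializeHom (δE : Derivation ℤ E E) (w : κ × ι → E) : GenericRing E ι κ →+* E :=
  eval₂Hom (diffAeval (R := E) δE fun _ : Unit => (1 : E)).toRingHom fun v => δE^[v.2] (w v.1)

theorem specializeHom_C (δE : Derivation ℤ E E) (w : κ × ι → E) (p : MvPolynomial (Unit × ℕ) E) :
    specializeHom δE w (C p) = diffAeval δE (fun _ => 1) p := eval₂Hom_C _ _ _

theorem specializeHom_X (δE : Derivation ℤ E E) (w : κ × ι → E) (v : (κ × ι) × ℕ) :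
    specializeHom δE w (X v) = δE^[v.2] (w v.1) := eval₂Hom_X' _ _ _

theorem specializeHom_C_C (δE : Derivation ℤ E E) (w : κ × ι → E) (a : E) :
    specializeHom δE w (C (C a)) = a := by
  rw [specializeHom_C]
  exact (diffAeval (R := E) δE fun _ : Unit => (1 : E)).commutes a

theorem specializeHom_derivation {δE : Derivation ℤ E E} (w : κ × ι → E) (p : GenericRing E ι κ) :
    specializeHom δE w (genericDerivation ι κ δE p) = δE (specializeHom δE w p) := by
  induction p using MvPolynomial.induction_on with
  | C a =>
    rw [prolong_C, specializeHom_C, specializeHom_C]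
    exact diffAeval_derivation (d := δE) (fun _ => rfl) _ (prolong_C _) (fun v k => prolong_X _ _) a
  | add p q hp hq => simp only [map_add, hp, hq]
  | mul_X p v hp =>
    rw [Derivation.leibniz, smul_eq_mul, smul_eq_mul, map_add, map_mul, map_mul, hp, prolong_X,
      map_mul, Derivation.leibniz, specializeHom_X, specializeHom_X, Function.iterate_succ_apply']
    rfl

variable (F) in
/-- Evaluation of differential polynomials in `y` at `Λ x`. -/
noncomputable def coneEval (δE : Derivation ℤ E E) (x : ι → E) :
    MvPolynomial (ι × ℕ) F →ₐ[F] MvPolynomial (Unit × ℕ) E :=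
  diffAeval (prolong Unit δE) fun l => X ((), 0) * C (x l)

theorem diffAeval_coneEval (δE : Derivation ℤ E E) (lam : E) (x : ι → E)
    (c : MvPolynomial (ι × ℕ) F) :
    diffAeval δE (fun _ => lam) (coneEval F δE x c) = diffAeval δE (fun l => lam * x l) c := by
  induction c using MvPolynomial.induction_on with
  | C a =>
    rw [← algebraMap_eq, AlgHom.commutes, AlgHom.commutes]
    exact (diffAeval (R := E) δE fun _ : Unit => lam).commutes _
  | add p q hp hq => simp only [map_add, hp, hq]
  | mul_X p v hp =>
    rw [map_mul, map_mul, map_mul, hp, coneEval, diffAeval_X, diffAeval_X,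
      Function.Semiconj.iterate_apply (diffAeval_derivation (d := δE) (dA := δE) (fun _ => rfl)
        (fun _ : Unit => lam) (prolong_C _) fun v k => prolong_X _ _), map_mul, diffAeval_X]
    exact congrArg (fun a => _ * δE^[v.2] (lam * a))
      ((diffAeval (R := E) δE fun _ : Unit => lam).commutes _)

variable [Fintype ι]

/-- The sum of the differential ideal generated by the `∑ l, u i l * y l` and the ideal of
differential polynomials in `y` vanishing at `Λ x`. -/
noncomputable def incidenceIdeal (δE : Derivation ℤ E E) (x : ι → E)
    (δ : MvPolynomial ((ι ⊕ κ × ι) × ℕ) F → MvPolynomial ((ι ⊕ κ × ι) × ℕ) F) :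
    Ideal (MvPolynomial ((ι ⊕ κ × ι) × ℕ) F) :=
  diffIdealGen δ (Set.range fun i : κ => ∑ l, X (Sum.inr (i, l), 0) * X (Sum.inl l, 0)) ⊔
    (RingHom.ker (coneEval F δE x)).map (rename (Prod.map Sum.inl id) :
      MvPolynomial (ι × ℕ) F →ₐ[F] MvPolynomial ((ι ⊕ κ × ι) × ℕ) F)

theorem incidenceIdeal_le {δE : Derivation ℤ E E}
    {δ : MvPolynomial ((ι ⊕ κ × ι) × ℕ) F → MvPolynomial ((ι ⊕ κ × ι) × ℕ) F} {x : ι → E}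
    {S : Set (MvPolynomial ((ι ⊕ κ × ι) × ℕ) F)}
    (hS : ∀ i : κ, ∑ l, X (Sum.inr (i, l), 0) * X (Sum.inl l, 0) ∈ S)
    (hS' : ∀ c, coneEval F δE x c = 0 → rename (Prod.map Sum.inl id) c ∈ S) :
    incidenceIdeal δE x δ ≤ diffIdealGen δ S := by
  refine sup_le (Ideal.span_mono ?_) (Ideal.map_le_iff_le_comap.2 fun c hc =>
    subset_diffIdealGen _ _ (hS' c hc))
  rintro _ ⟨_, ⟨i, rfl⟩, k, rfl⟩
  exact ⟨_, hS i, k, rfl⟩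

variable [DecidableEq ι]

/-- The point with `y = Λ x` and generic `u`, except that `u i j` is determined by
`∑ l, u i l * x l = 0`. -/
noncomputable def genericIncidencePoint (κ : Type*) (x : ι → E) (j : ι) :
    ι ⊕ κ × ι → GenericRing E ι κ :=
  Sum.elim (fun l => C (X ((), 0) * C (x l))) fun q =>
    if q.2 = j then ∑ l ∈ Finset.univ.erase j, X ((q.1, l), 0) * C (C (-(x l / x j))) else X (q, 0)

variable (F κ) in
/-- Evaluation of differential polynomials at `genericIncidencePoint`. -/
noncomputable def genericEval (δE : Derivation ℤ E E) (x : ι → E) (j : ι) :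
    MvPolynomial ((ι ⊕ κ × ι) × ℕ) F →ₐ[F] GenericRing E ι κ :=
  diffAeval (genericDerivation ι κ δE) (genericIncidencePoint κ x j)

theorem genericEval_X_inr_of_ne (δE : Derivation ℤ E E) (x : ι → E) {j : ι} {q : κ × ι}
    (hq : q.2 ≠ j) (k : ℕ) : genericEval F κ δE x j (X (Sum.inr q, k)) = X (q, k) := by
  rw [genericEval, diffAeval_X]
  simp only [genericIncidencePoint, Sum.elim_inr, if_neg hq]
  exact prolong_iterate_X _ _ _

theorem genericEval_X_inl (δE : Derivation ℤ E E) (x : ι → E) (j l : ι) (k : ℕ) :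
    genericEval F κ δE x j (X (Sum.inl l, k)) = C (coneEval F δE x (X (l, k))) := by
  rw [genericEval, coneEval, diffAeval_X, diffAeval_X]
  exact prolong_iterate_C _ _ _

theorem genericEval_rename (δE : Derivation ℤ E E) (x : ι → E) (j : ι)
    (c : MvPolynomial (ι × ℕ) F) :
    genericEval F κ δE x j (rename (Prod.map Sum.inl id) c) = C (coneEval F δE x c) := by
  induction c using MvPolynomial.induction_on with
  | C a =>
    rw [rename_C]
    exact ((genericEval F κ δE x j).commutes a).trans
      (congrArg C ((coneEval F δE x).commutes a).symm)
  | add p q hp hq => simp only [map_add, hp, hq]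
  | mul_X p v hp =>
    rw [map_mul, map_mul, hp, rename_X, map_mul, map_mul]
    exact congrArg _ (genericEval_X_inl _ _ _ _ _)

theorem genericEval_incidence (δE : Derivation ℤ E E) {x : ι → E} {j : ι} (hj : x j ≠ 0) (i : κ) :
    genericEval F κ δE x j (∑ l, X (Sum.inr (i, l), 0) * X (Sum.inl l, 0)) = 0 := by
  rw [← Finset.add_sum_erase _ _ (Finset.mem_univ j), map_add, map_sum]
  simp only [genericEval, map_mul, diffAeval_X, Function.iterate_zero, id_eq, genericIncidencePoint,
    Sum.elim_inl, Sum.elim_inr, if_true]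
  rw [Finset.sum_mul, ← Finset.sum_add_distrib]
  refine Finset.sum_eq_zero fun l hl => ?_
  rw [if_neg (Finset.ne_of_mem_erase hl), mul_assoc, ← mul_add, mul_left_comm, ← mul_add,
    ← C_mul, ← C_add]
  have : C (-(x l / x j)) * C (x j) + C (x l) = (0 : MvPolynomial (Unit × ℕ) E) := by
    rw [← C_mul, ← C_add, neg_mul, div_mul_cancel₀ _ hj, neg_add_cancel, C_0]
  rw [this, C_0, mul_zero, mul_zero]

variable {dF : Derivation ℤ F F} {δE : Derivation ℤ E E}
  {δ : Derivation ℤ (MvPolynomial ((ι ⊕ κ × ι) × ℕ) F) (MvPolynomial ((ι ⊕ κ × ι) × ℕ) F)}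

theorem genericEval_derivation (hcompat : ∀ a : F, δE (algebraMap F E a) = algebraMap F E (dF a))
    (hδC : ∀ a : F, δ (C a) = C (dF a)) (hδX : ∀ v k, δ (X (v, k)) = X (v, k + 1))
    (x : ι → E) (j : ι) (p : MvPolynomial ((ι ⊕ κ × ι) × ℕ) F) :
    genericEval F κ δE x j (δ p) = genericDerivation ι κ δE (genericEval F κ δE x j p) := by
  refine diffAeval_derivation (d := dF) (fun a => ?_) _ hδC hδX p
  change prolong _ _ (C (C (algebraMap F E a))) = C (C (algebraMap F E (dF a)))
  rw [prolong_C, prolong_C, hcompat]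

theorem diffIdealGen_incidence_le_ker
    (hcompat : ∀ a : F, δE (algebraMap F E a) = algebraMap F E (dF a))
    (hδC : ∀ a : F, δ (C a) = C (dF a)) (hδX : ∀ v k, δ (X (v, k)) = X (v, k + 1))
    {x : ι → E} {j : ι} (hj : x j ≠ 0) :
    diffIdealGen δ (Set.range fun i : κ => ∑ l, X (Sum.inr (i, l), 0) * X (Sum.inl l, 0)) ≤
      RingHom.ker (genericEval F κ δE x j) := by
  refine Ideal.span_le.2 ?_
  rintro _ ⟨_, ⟨i, rfl⟩, k, rfl⟩
  refine (Function.Semiconj.iterate_apply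
    (genericEval_derivation hcompat hδC hδX x j) k _).trans ?_
  rw [genericEval_incidence δE hj]
  exact Function.iterate_fixed (map_zero _) k

theorem incidenceIdeal_le_ker
    (hcompat : ∀ a : F, δE (algebraMap F E a) = algebraMap F E (dF a))
    (hδC : ∀ a : F, δ (C a) = C (dF a)) (hδX : ∀ v k, δ (X (v, k)) = X (v, k + 1))
    {x : ι → E} {j : ι} (hj : x j ≠ 0) :
    incidenceIdeal δE x δ ≤ RingHom.ker (genericEval F κ δE x j) := by
  refine sup_le (diffIdealGen_incidence_le_ker hcompat hδC hδX hj) ?_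
  refine Ideal.map_le_iff_le_comap.2 fun c hc => ?_
  rw [Ideal.mem_comap, RingHom.mem_ker, genericEval_rename, (RingHom.mem_ker).1 hc, C_0]

theorem reducibleModulo_eq_top (hδC : ∀ a : F, δ (C a) = C (dF a))
    (hδX : ∀ v k, δ (X (v, k)) = X (v, k + 1)) (j : ι) :
    reducibleModulo (supported F (freeVars κ j)) (X (Sum.inl j, 0))
      (X_inl_mem_supported_freeVars j j 0)
      (diffIdealGen δ (Set.range fun i : κ => ∑ l, X (Sum.inr (i, l), 0) * X (Sum.inl l, 0))) =
      ⊤ := by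
  rw [eq_top_iff, ← adjoin_range_X, Algebra.adjoin_le_iff]
  rintro _ ⟨⟨v, k⟩, rfl⟩
  induction k with
  | zero =>
    rcases v with l | ⟨i, l⟩
    · exact le_reducibleModulo (X_inl_mem_supported_freeVars j l 0)
    · by_cases hl : l = j
      · subst hl
        refine mem_reducibleModulo_of_mul_add_mem (r := ∑ m ∈ Finset.univ.erase l,
          X (Sum.inr (i, m), 0) * X (Sum.inl m, 0)) (sum_mem fun m hm => mul_mem
            (X_inr_mem_supported_freeVars (Finset.ne_of_mem_erase hm) _)
            (X_inl_mem_supported_freeVars _ _ _)) ?_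
        rw [Finset.add_sum_erase Finset.univ (fun m => X (Sum.inr (i, m), 0) * X (Sum.inl m, 0))
          (Finset.mem_univ l)]
        exact subset_diffIdealGen _ _ ⟨i, rfl⟩
      · exact le_reducibleModulo (X_inr_mem_supported_freeVars hl 0)
  | succ k ih =>
    rw [← hδX]
    refine derivation_mem_reducibleModulo (fun g hg => ?_)
      (fun g hg => derivation_mem_diffIdealGen δ hg) ih
    refine derivation_mem_supported subset_rfl hδC (fun v hv => ?_) hg
    rw [show v = (v.1, v.2) from rfl, hδX]
    exact Algebra.subset_adjoin ⟨(v.1, v.2 + 1), hv, rfl⟩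

theorem mem_map_ker_of_genericEval_eq_zero {x : ι → E} {j : ι}
    {g : MvPolynomial ((ι ⊕ κ × ι) × ℕ) F} (hg : g ∈ supported F (freeVars κ j))
    (h0 : genericEval F κ δE x j g = 0) :
    g ∈ (RingHom.ker (coneEval F δE x)).map (rename (Prod.map Sum.inl id) :
      MvPolynomial (ι × ℕ) F →ₐ[F] MvPolynomial ((ι ⊕ κ × ι) × ℕ) F) := by
  let e : (ι ⊕ κ × ι) × ℕ ≃ ((κ × ι) × ℕ) ⊕ (ι × ℕ) :=
    (Equiv.sumProdDistrib _ _ _).trans (Equiv.sumComm _ _)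
  have key : map (coneEval F δE x : MvPolynomial (ι × ℕ) F →+* MvPolynomial (Unit × ℕ) E)
      (sumAlgEquiv F _ _ (rename e g)) = genericEval F κ δE x j g := by
    clear h0
    induction hg using Algebra.adjoin_induction with
    | mem _ hv =>
      obtain ⟨⟨l | q, k⟩, hv, rfl⟩ := hv
      · rw [genericEval_X_inl, rename_X]
        simp [e]
      · rw [genericEval_X_inr_of_ne _ _ (fun h => hv q.1 (by rw [← h])), rename_X]
        simp [e]
    | algebraMap a =>
      rw [AlgHom.commutes, AlgEquiv.commutes, AlgHom.commutes]
      change map _ (C (C a)) = C (C (algebraMap F E a))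
      rw [map_C]
      exact congrArg C ((coneEval F δE x).commutes a)
    | add p q _ _ hp hq => simp only [map_add, hp, hq]
    | mul p q _ _ hp hq => simp only [map_mul, hp, hq]
  have h1 := Ideal.mem_map_of_mem (rename e.symm)
    (mem_map_rename_inr_ker (coneEval F δE x) (key.trans h0))
  rw [rename_rename, Equiv.symm_comp_self, rename_id_apply] at h1
  refine (Ideal.map_le_iff_le_comap.2 (Ideal.map_le_iff_le_comap.2 fun c hc => ?_)) h1
  rw [Ideal.mem_comap, Ideal.mem_comap, rename_rename]
  exact Ideal.mem_map_of_mem (rename (Prod.map Sum.inl id)) hc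

theorem exists_pow_mul_mem_incidenceIdeal
    (hcompat : ∀ a : F, δE (algebraMap F E a) = algebraMap F E (dF a))
    (hδC : ∀ a : F, δ (C a) = C (dF a)) (hδX : ∀ v k, δ (X (v, k)) = X (v, k + 1))
    {x : ι → E} {j : ι} (hj : x j ≠ 0) {g : MvPolynomial ((ι ⊕ κ × ι) × ℕ) F}
    (hg : genericEval F κ δE x j g = 0) :
    ∃ e : ℕ, X (Sum.inl j, 0) ^ e * g ∈ incidenceIdeal δE x δ := by
  obtain ⟨e, g', hg', h⟩ := mem_reducibleModulo.1
    ((reducibleModulo_eq_top hδC hδX j).ge (Algebra.mem_top (R := F) (x := g)))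
  refine ⟨e, ?_⟩
  have h1 := diffIdealGen_incidence_le_ker hcompat hδC hδX hj h
  rw [RingHom.mem_ker, map_sub, map_mul, hg, mul_zero, zero_sub, neg_eq_zero] at h1
  rw [← sub_add_cancel (X (Sum.inl j, 0) ^ e * g) g']
  exact add_mem (Ideal.mem_sup_left h)
    (Ideal.mem_sup_right (mem_map_ker_of_genericEval_eq_zero hg' h1))

theorem genericEval_eq_zero_of_genericEval_eq_zero
    (hcompat : ∀ a : F, δE (algebraMap F E a) = algebraMap F E (dF a))
    (hδC : ∀ a : F, δ (C a) = C (dF a)) (hδX : ∀ v k, δ (X (v, k)) = X (v, k + 1))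
    {x : ι → E} {j j' : ι} (hj : x j ≠ 0) (hj' : x j' ≠ 0)
    {g : MvPolynomial ((ι ⊕ κ × ι) × ℕ) F} (hg : genericEval F κ δE x j g = 0) :
    genericEval F κ δE x j' g = 0 := by
  obtain ⟨e, h⟩ := exists_pow_mul_mem_incidenceIdeal hcompat hδC hδX hj hg
  have h1 := incidenceIdeal_le_ker hcompat hδC hδX hj' h
  rw [RingHom.mem_ker, map_mul, map_pow, mul_eq_zero] at h1
  refine h1.resolve_left (pow_ne_zero _ ?_)
  simp [genericEval, diffAeval_X, genericIncidencePoint, hj, X_ne_zero]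

theorem prolong_iterate_X_mul_C_sub_mem {R σ : Type*} [CommRing R] [Algebra ℤ R]
    (d : Derivation ℤ R R) (q : σ) (c : R) (k : ℕ) :
    (prolong σ d)^[k] (X (q, 0) * C c) - X (q, k) * C c ∈
      supported R {v : σ × ℕ | v.1 = q ∧ v.2 < k} := by
  induction k with
  | zero => simp
  | succ k ih =>
    have h1 : prolong σ d ((prolong σ d)^[k] (X (q, 0) * C c) - X (q, k) * C c) ∈
        supported R {v : σ × ℕ | v.1 = q ∧ v.2 < k + 1} := by
      have hst : {v : σ × ℕ | v.1 = q ∧ v.2 < k} ⊆ {v | v.1 = q ∧ v.2 < k + 1} :=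
        fun v hv => ⟨hv.1, hv.2.trans k.lt_succ_self⟩
      refine derivation_mem_supported hst (prolong_C d) (fun v hv => ?_) ih
      rw [prolong_X]
      exact Algebra.subset_adjoin ⟨(v.1, v.2 + 1), ⟨hv.1, Nat.succ_lt_succ hv.2⟩, rfl⟩
    rw [map_sub, Derivation.leibniz, prolong_X, prolong_C,
      ← Function.iterate_succ_apply' (f := prolong σ d), smul_eq_mul, smul_eq_mul,
      mul_comm (C c), ← sub_sub, sub_right_comm] at h1
    have h2 : (X (q, k) * C (d c) : MvPolynomial (σ × ℕ) R) ∈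
        supported R {v : σ × ℕ | v.1 = q ∧ v.2 < k + 1} :=
      mul_mem (Algebra.subset_adjoin ⟨_, ⟨rfl, k.lt_succ_self⟩, rfl⟩)
        (Subalgebra.algebraMap_mem _ _)
    have h3 := add_mem h1 h2
    rwa [sub_add_cancel] at h3

theorem pderiv_prolong_iterate_X_mul_C {R σ : Type*} [CommRing R] [Algebra ℤ R]
    (d : Derivation ℤ R R) {q w : σ} (c : R) {k h : ℕ} (hk : q = w → k ≤ h) :
    pderiv (w, h) ((prolong σ d)^[k] (X (q, 0) * C c)) = pderiv (w, h) (X (q, k)) * C c := by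
  have h1 := mem_supported.1 (prolong_iterate_X_mul_C_sub_mem d q c k)
  have h2 := pderiv_eq_zero_of_notMem_vars fun hw : (w, h) ∈ _ =>
    (h1 hw).2.not_ge (hk (h1 hw).1.symm)
  rw [map_sub, sub_eq_zero] at h2
  rw [h2, Derivation.leibniz, derivation_C, smul_zero, zero_add, smul_eq_mul, mul_comm]

theorem Derivation.iterate_sum {A α : Type*} [CommRing A] [Algebra ℤ A] (D : Derivation ℤ A A)
    (s : Finset α) (g : α → A) (k : ℕ) : D^[k] (∑ a ∈ s, g a) = ∑ a ∈ s, D^[k] (g a) := by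
  induction k with
  | zero => rfl
  | succ k ih => simp only [Function.iterate_succ_apply', ih, map_sum]

theorem pderiv_genericEval (x : ι → E) {j m : ι} (hm : m ≠ j) (i : κ) (h : ℕ)
    {f : MvPolynomial ((ι ⊕ κ × ι) × ℕ) F}
    (hf : f ∈ supported F {v | ∃ q k, v = (Sum.inr q, k) ∧ (q.1 = i → k ≤ h)}) :
    pderiv ((i, m), h) (genericEval F κ δE x j f) =
      genericEval F κ δE x j (pderiv (Sum.inr (i, m), h) f) +
        C (C (-(x m / x j))) * genericEval F κ δE x j (pderiv (Sum.inr (i, j), h) f) := by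
  classical
  induction hf using Algebra.adjoin_induction with
  | mem _ hv =>
    obtain ⟨_, ⟨⟨i', l⟩, k, rfl, hk⟩, rfl⟩ := hv
    by_cases hl : l = j
    · subst hl
      rw [genericEval, diffAeval_X]
      simp only [genericIncidencePoint, Sum.elim_inr, if_true]
      rw [Derivation.iterate_sum, map_sum, Finset.sum_congr rfl fun a _ =>
        pderiv_prolong_iterate_X_mul_C (prolong Unit δE) _ fun h => hk (congrArg Prod.fst h)]
      rw [pderiv_X_of_ne (by simp [hm.symm]), map_zero, zero_add, pderiv_X]
      rw [Finset.sum_eq_single m]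
      · simp only [pderiv_X, Pi.single_apply, Prod.mk.injEq, Sum.inr.injEq, and_true]
        split_ifs <;> simp
      · intro b _ hb
        rw [pderiv_X_of_ne (by simp [hb]), zero_mul]
      · intro h
        exact absurd (Finset.mem_erase.2 ⟨hm, Finset.mem_univ _⟩) h
    · rw [genericEval_X_inr_of_ne δE x hl,
        show pderiv (Sum.inr (i, j), h) (X (Sum.inr (i', l), k)) = 0 from
        pderiv_X_of_ne (by simp [hl]), map_zero, mul_zero, add_zero]
      simp only [pderiv_X, Pi.single_apply, Prod.mk.injEq, Sum.inr.injEq]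
      split_ifs <;> simp
  | algebraMap a =>
    rw [AlgHom.commutes, algebraMap_eq, derivation_C, derivation_C, map_zero, mul_zero, add_zero]
    exact derivation_C _ _
  | add p q _ _ hp hq =>
    simp only [map_add, hp, hq]
    ring
  | mul p q _ _ hp hq =>
    simp only [Derivation.leibniz, smul_eq_mul, map_add, map_mul, hp, hq]
    ring

theorem specializeHom_genericEval {x : ι → E} {j : ι}
    (hj : x j ≠ 0) {w : κ × ι → E} (hw : ∀ i, ∑ l, w (i, l) * x l = 0)
    (f : MvPolynomial ((ι ⊕ κ × ι) × ℕ) F) :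
    specializeHom δE w (genericEval F κ δE x j f) = diffAeval δE (Sum.elim x w) f := by
  induction f using MvPolynomial.induction_on with
  | C a =>
    rw [← algebraMap_eq, AlgHom.commutes, AlgHom.commutes]
    exact specializeHom_C_C δE w _
  | add p q hp hq => simp only [map_add, hp, hq]
  | mul_X p v hp =>
    obtain ⟨v, k⟩ := v
    rw [map_mul, map_mul, map_mul, hp, genericEval, diffAeval_X, diffAeval_X,
      Function.Semiconj.iterate_apply (specializeHom_derivation w)]
    congr 2
    rcases v with l | ⟨i, l⟩
    · simp only [genericIncidencePoint, Sum.elim_inl, specializeHom_C, map_mul, diffAeval_X]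
      exact (congrArg _ ((diffAeval (R := E) δE fun _ : Unit => (1 : E)).commutes _)).trans
        (one_mul _)
    · simp only [genericIncidencePoint, Sum.elim_inr]
      split_ifs with hl
      · subst hl
        rw [map_sum]
        simp only [map_mul, specializeHom_X, specializeHom_C_C, Function.iterate_zero, id_eq]
        have h1 := hw i
        rw [← Finset.add_sum_erase _ _ (Finset.mem_univ l)] at h1
        refine mul_right_cancel₀ hj ?_
        rw [eq_neg_of_add_eq_zero_left h1, Finset.sum_mul, ← Finset.sum_neg_distrib]
        refine Finset.sum_congr rfl fun m _ => ?_
        field_simp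
      · exact specializeHom_X _ _ _

theorem genericEval_mem {x : ι → E} {j : ι} (T : Subring (GenericRing E ι κ))
    (hT : ∀ t ∈ T, genericDerivation ι κ δE t ∈ T) (hF : ∀ a : F, C (C (algebraMap F E a)) ∈ T)
    (hx : ∀ l, C (C (x l / x j)) ∈ T) (hX : ∀ q : κ × ι, q.2 ≠ j → X (q, 0) ∈ T)
    {f : MvPolynomial ((ι ⊕ κ × ι) × ℕ) F}
    (hf : f ∈ supported F {v | ∃ q k, v = (Sum.inr q, k)}) : genericEval F κ δE x j f ∈ T := by
  induction hf using Algebra.adjoin_induction with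
  | mem _ hv =>
    obtain ⟨_, ⟨q, k, rfl⟩, rfl⟩ := hv
    rw [genericEval, diffAeval_X]
    induction k with
    | zero =>
      simp only [genericIncidencePoint, Sum.elim_inr, Function.iterate_zero, id_eq]
      split_ifs with hq
      · refine sum_mem fun l hl => mul_mem (hX _ (Finset.ne_of_mem_erase hl)) ?_
        rw [C_neg, C_neg]
        exact neg_mem (hx l)
      · exact hX q hq
    | succ k ih =>
      rw [Function.iterate_succ_apply']
      exact hT _ ih
  | algebraMap a =>
    rw [AlgHom.commutes]
    exact hF a
  | add p q _ _ hp hq => rw [map_add]; exact add_mem hp hq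
  | mul p q _ _ hp hq => rw [map_mul]; exact mul_mem hp hq

theorem genericEval_eq_zero_of_algebraicIndependent {x : ι → E} {j : ι}
    (hj : x j ≠ 0) {w : κ × ι → E} (hw : ∀ i, ∑ l, w (i, l) * x l = 0)
    {L : IntermediateField F E} (hL : ∀ a ∈ L, δE a ∈ L) (hx : ∀ l, x l / x j ∈ L)
    {τ : Type*} {s : τ → ι} (hs : ∀ l, l ≠ j → ∃ t, s t = l)
    (hind : AlgebraicIndependent L fun p : (κ × τ) × ℕ => δE^[p.2] (w (p.1.1, s p.1.2)))
    {f : MvPolynomial ((ι ⊕ κ × ι) × ℕ) F}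
    (hf : f ∈ supported F {v | ∃ q k, v = (Sum.inr q, k)})
    (h0 : diffAeval δE (Sum.elim x w) f = 0) : genericEval F κ δE x j f = 0 := by
  let φ : MvPolynomial ((κ × τ) × ℕ) L →+* GenericRing E ι κ :=
    eval₂Hom ((C.comp C).comp (algebraMap L E)) fun v => X ((v.1.1, s v.1.2), v.2)
  have hφC (a : E) (ha : a ∈ L) : C (C a) ∈ φ.range := ⟨C ⟨a, ha⟩, eval₂Hom_C _ _ _⟩
  have hφX (v : (κ × τ) × ℕ) : φ (X v) = X ((v.1.1, s v.1.2), v.2) := eval₂Hom_X' _ _ _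
  have hD (t) (ht : t ∈ φ.range) : genericDerivation ι κ δE t ∈ φ.range := by
    obtain ⟨p, rfl⟩ := ht
    induction p using MvPolynomial.induction_on with
    | C a =>
      rw [show φ (C a) = C (C (a : E)) from eval₂Hom_C _ _ _, prolong_C, prolong_C]
      exact hφC _ (hL _ a.2)
    | add p q hp hq => rw [map_add, map_add]; exact add_mem hp hq
    | mul_X p v hp =>
      rw [map_mul, Derivation.leibniz, smul_eq_mul, smul_eq_mul]
      refine add_mem (mul_mem ⟨p, rfl⟩ ?_) (mul_mem ⟨_, rfl⟩ hp)
      rw [hφX, prolong_X]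
      exact ⟨X (v.1, v.2 + 1), hφX _⟩
  obtain ⟨g, hg⟩ := genericEval_mem φ.range hD (fun a => hφC _ (L.algebraMap_mem a))
    (fun l => hφC _ (hx l)) (fun q hq => by
      obtain ⟨t, ht⟩ := hs _ hq
      exact ⟨X ((q.1, t), 0), by rw [hφX, ht]⟩) hf
  have hcomp (p : MvPolynomial ((κ × τ) × ℕ) L) : specializeHom δE w (φ p) =
      aeval (R := L) (fun v : (κ × τ) × ℕ => δE^[v.2] (w (v.1.1, s v.1.2))) p := by
    induction p using MvPolynomial.induction_on with
    | C a =>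
      rw [show φ (C a) = C (C (a : E)) from eval₂Hom_C _ _ _, specializeHom_C_C, aeval_C]
      rfl
    | add p q hp hq => rw [map_add, map_add, map_add, hp, hq]
    | mul_X p v hp => rw [map_mul, map_mul, map_mul, hp, hφX, specializeHom_X, aeval_X]
  have h1 : specializeHom δE w (φ g) = 0 := by
    rw [hg, specializeHom_genericEval hj hw, h0]
  have h2 : g = 0 := hind.eq_zero_of_aeval_eq_zero g ((hcomp g).symm.trans h1)
  rw [← hg, h2, map_zero]

theorem mul_sub_mul_eq_zero_of_add_mul_eq_zero {A : Type*} [CommRing A] {a b r s t v : A}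
    (h : t + r * s = 0) (hr : r * b + a = 0) : s * (v * a) - t * (v * b) = 0 := by
  linear_combination v * s * hr - v * b * h

theorem genericEval_pderiv_mul_sub {x : ι → E} {j m : ι} (hj : x j ≠ 0) (hm : m ≠ j) (i : κ)
    (h : ℕ) {f : MvPolynomial ((ι ⊕ κ × ι) × ℕ) F}
    (hf : f ∈ supported F {v | ∃ q k, v = (Sum.inr q, k) ∧ (q.1 = i → k ≤ h)})
    (h0 : genericEval F κ δE x j f = 0) :
    genericEval F κ δE x j (pderiv (Sum.inr (i, j), h) f * X (Sum.inl m, 0) -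
      pderiv (Sum.inr (i, m), h) f * X (Sum.inl j, 0)) = 0 := by
  have h1 := pderiv_genericEval (δE := δE) x hm i h hf
  rw [h0, map_zero] at h1
  rw [map_sub, map_mul, map_mul, genericEval_X_inl, genericEval_X_inl, coneEval, diffAeval_X,
    diffAeval_X]
  simp only [Function.iterate_zero, id_eq, C_mul]
  refine mul_sub_mul_eq_zero_of_add_mul_eq_zero h1.symm ?_
  rw [← C_mul, ← C_mul, neg_mul, div_mul_cancel₀ _ hj, ← C_add, ← C_add, neg_add_cancel, C_0, C_0]

end GenericPoint

theorem IntermediateField.derivation_mem_adjoin {F E : Type*} [Field F] [Field E] [Algebra F E]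
    {dF : Derivation ℤ F F} {δE : Derivation ℤ E E}
    (hcompat : ∀ a : F, δE (algebraMap F E a) = algebraMap F E (dF a)) {s : Set E}
    (hs : ∀ a ∈ s, δE a ∈ IntermediateField.adjoin F s) {a : E}
    (ha : a ∈ IntermediateField.adjoin F s) : δE a ∈ IntermediateField.adjoin F s := by
  induction ha using IntermediateField.adjoin_induction with
  | mem a ha => exact hs a ha
  | algebraMap a => rw [hcompat]; exact IntermediateField.algebraMap_mem _ _
  | add a b _ _ ha hb => rw [map_add]; exact add_mem ha hb
  | mul a b ha' hb' ha hb =>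
    rw [Derivation.leibniz, smul_eq_mul, smul_eq_mul]
    exact add_mem (mul_mem ha' hb) (mul_mem hb' ha)
  | inv a ha' ha =>
    rw [Derivation.leibniz_inv, smul_eq_mul, neg_mul]
    exact neg_mem (mul_mem (pow_mem (inv_mem ha') _) ha)

/-- **Key step in the proof of Theorem 4.7, second part.**  In the setting of Theorem 4.2, if
`f ∈ F{u_0,…,u_d}` vanishes at the generic point `(ζ_0,u_0;…;ζ_d,u_d)` and has order at most
`h` in the block `u_0`, then with `S_f = ∂f/∂u_{00}^{(h)}`, for each `ρ` the polynomial
`A_ρ = S_f·y_ρ − (∂f/∂u_{0ρ}^{(h)})·y_0` lies in `J = [I ∪ {P_0,…,P_d}] : (Y)^∞`. -/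
theorem stmt_11 (F E : Type*) [Field F] [CharZero F] [Field E] [Algebra F E]
    (dF : Derivation ℤ F F) (δE : Derivation ℤ E E)
    (hcompat : ∀ a : F, δE (algebraMap F E a) = algebraMap F E (dF a))
    (n d : ℕ)
    (δ : Derivation ℤ (MvPolynomial ((Fin (n + 1) ⊕ Fin (d + 1) × Fin (n + 1)) × ℕ) F)
      (MvPolynomial ((Fin (n + 1) ⊕ Fin (d + 1) × Fin (n + 1)) × ℕ) F))
    (hδC : ∀ a : F, δ (C a) = C (dF a))
    (hδX : ∀ (v : Fin (n + 1) ⊕ Fin (d + 1) × Fin (n + 1)) (k : ℕ),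
      δ (X (v, k)) = X (v, k + 1))
    (ξ : Fin n → E) (u : Fin (d + 1) → Fin n → E)
    (hu : AlgebraicIndependent
      (IntermediateField.adjoin F (Set.range fun p : Fin n × ℕ => (⇑δE)^[p.2] (ξ p.1)))
      (fun p : (Fin (d + 1) × Fin n) × ℕ => (⇑δE)^[p.2] (u p.1.1 p.1.2)))
    (ζ : Fin (d + 1) → E) (hζ : ∀ i, ζ i = -∑ j : Fin n, u i j * ξ j)
    (Iset : Set (MvPolynomial ((Fin (n + 1) ⊕ Fin (d + 1) × Fin (n + 1)) × ℕ) F))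
    (hIset : Iset = {f | (∀ v ∈ f.vars, ∃ j k, v = (Sum.inl j, k)) ∧
      ∀ lam : E, aeval (fun v : (Fin (n + 1) ⊕ Fin (d + 1) × Fin (n + 1)) × ℕ =>
        (⇑δE)^[v.2]
          (Sum.elim (Fin.cons lam fun j : Fin n => lam * ξ j : Fin (n + 1) → E)
            (fun q => (Fin.cons (ζ q.1) (u q.1) : Fin (n + 1) → E) q.2) v.1)) f = 0})
    (P : Fin (d + 1) → MvPolynomial ((Fin (n + 1) ⊕ Fin (d + 1) × Fin (n + 1)) × ℕ) F)
    (hP : ∀ i, P i = ∑ j : Fin (n + 1), X (Sum.inr (i, j), 0) * X (Sum.inl j, 0))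
    (ev : MvPolynomial ((Fin (n + 1) ⊕ Fin (d + 1) × Fin (n + 1)) × ℕ) F →ₐ[F] E)
    (hev : ev = aeval (fun v : (Fin (n + 1) ⊕ Fin (d + 1) × Fin (n + 1)) × ℕ =>
      (⇑δE)^[v.2] (Sum.elim (Fin.cons 1 ξ : Fin (n + 1) → E)
        (fun q => (Fin.cons (ζ q.1) (u q.1) : Fin (n + 1) → E) q.2) v.1)))
    (Jsat : Set (MvPolynomial ((Fin (n + 1) ⊕ Fin (d + 1) × Fin (n + 1)) × ℕ) F))
    (hJsat : Jsat = {f | ∀ j : Fin (n + 1), ∃ e : ℕ,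
      X ((Sum.inl j : Fin (n + 1) ⊕ Fin (d + 1) × Fin (n + 1)), 0) ^ e * f ∈
        diffIdealGen (⇑δ) (Iset ∪ Set.range P)})
    (f : MvPolynomial ((Fin (n + 1) ⊕ Fin (d + 1) × Fin (n + 1)) × ℕ) F)
    (hfU : ∀ v ∈ f.vars, ∃ q k, v = (Sum.inr q, k))
    (hfvan : ev f = 0)
    (h : ℕ)
    (hford : ∀ (j : Fin (n + 1)) (k : ℕ),
      ((Sum.inr ((0 : Fin (d + 1)), j) : Fin (n + 1) ⊕ Fin (d + 1) × Fin (n + 1)), k) ∈ f.vars →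
        k ≤ h) :
    ∀ ρ : Fin n,
      pderiv ((Sum.inr ((0 : Fin (d + 1)), (0 : Fin (n + 1)))
            : Fin (n + 1) ⊕ Fin (d + 1) × Fin (n + 1)), h) f *
          X ((Sum.inl ρ.succ : Fin (n + 1) ⊕ Fin (d + 1) × Fin (n + 1)), 0) -
        pderiv ((Sum.inr ((0 : Fin (d + 1)), ρ.succ)
            : Fin (n + 1) ⊕ Fin (d + 1) × Fin (n + 1)), h) f *
          X ((Sum.inl (0 : Fin (n + 1)) : Fin (n + 1) ⊕ Fin (d + 1) × Fin (n + 1)), 0) ∈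
      Jsat := by
  subst hev hJsat hIset
  set x : Fin (n + 1) → E := Fin.cons 1 ξ with hx
  set w : Fin (d + 1) × Fin (n + 1) → E :=
    fun q => (Fin.cons (ζ q.1) (u q.1) : Fin (n + 1) → E) q.2 with hw
  have hx0 : x 0 ≠ 0 := by simp [hx]
  have hlam (lam : E) : (Fin.cons lam fun j : Fin n => lam * ξ j : Fin (n + 1) → E) =
      fun l => lam * x l := by
    funext l
    refine Fin.cases ?_ (fun _ => ?_) l <;> simp [hx]
  simp only [hlam]
  have hsupp : f ∈ supported F {v | ∃ q k, v = (Sum.inr q, k) ∧ (q.1 = 0 → k ≤ h)} := by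
    refine mem_supported.2 fun v hv => ?_
    obtain ⟨⟨i, l⟩, k, rfl⟩ := hfU v hv
    refine ⟨_, _, rfl, ?_⟩
    rintro rfl
    exact hford l k hv
  have hgen : genericEval F (Fin (d + 1)) δE x 0 f = 0 := by
    refine genericEval_eq_zero_of_algebraicIndependent (w := w) (τ := Fin n) (s := Fin.succ)
      hx0 (fun i => ?_)
      (fun a ha => IntermediateField.derivation_mem_adjoin hcompat ?_ ha) (fun l => ?_)
      (fun l hl => Fin.exists_succ_eq.2 hl) hu (mem_supported.2 fun v hv => hfU v hv) hfvan
    · simp [Fin.sum_univ_succ, hw, hx, hζ]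
    · rintro _ ⟨⟨j, k⟩, rfl⟩
      exact IntermediateField.subset_adjoin _ _
        ⟨(j, k + 1), Function.iterate_succ_apply' _ _ _⟩
    · refine Fin.cases ?_ (fun m => ?_) l
      · rw [div_self hx0]
        exact one_mem _
      · rw [show x 0 = 1 from rfl, div_one]
        exact IntermediateField.subset_adjoin _ _ ⟨(m, 0), rfl⟩
  intro ρ j
  have hA := genericEval_pderiv_mul_sub hx0 ρ.succ_ne_zero 0 h hsupp hgen
  by_cases hj : x j = 0
  · refine ⟨1, Ideal.mul_mem_right _ _ (subset_diffIdealGen _ _ (Or.inl ⟨fun v hv => ?_,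
      fun lam => ?_⟩))⟩
    · rw [pow_one, vars_X, Finset.mem_singleton] at hv
      exact ⟨_, _, hv⟩
    · rw [pow_one, aeval_X]
      simp [hj]
  · obtain ⟨e, he⟩ := exists_pow_mul_mem_incidenceIdeal hcompat hδC hδX hj
      (genericEval_eq_zero_of_genericEval_eq_zero hcompat hδC hδX hx0 hj hA)
    refine ⟨e, incidenceIdeal_le (fun i => Or.inr ⟨i, hP i⟩) (fun c hc => Or.inl ⟨fun v hv => ?_,
      fun lam => ?_⟩) he⟩
    · obtain ⟨⟨l, k⟩, -, rfl⟩ := Finset.mem_image.1 (vars_rename _ _ hv)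
      exact ⟨l, k, rfl⟩
    · rw [aeval_rename]
      refine (diffAeval_coneEval δE lam x c).symm.trans ?_
      rw [hc, map_zero]
end

section
/- (Wronskian–Leibniz identity used in the proof of Theorem 5.3.) Let R be a commutative ring and D : R → R a derivation (additive and satisfying D(ab) = a·D(b) + b·D(a)). Then for all a, b ∈ R and every m ≥ 1: a·D^m(b) = D^{m−1}(a·D(b) − D(a)·b) + Σ_{s=1}^{m−1} (binom(m−1, s) − binom(m−1, s−1))·D^{m−s}(a)·D^{s}(b) + D^{m}(a)·b. -/
/-- The general Leibniz rule for the iterates of a derivation of a commutative ring. -/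
theorem Derivation.iterate_mul {S R : Type*} [CommRing S] [CommRing R] [Algebra S R]
    (D : Derivation S R R) (n : ℕ) (a b : R) :
    D^[n] (a * b) =
      ∑ ij ∈ Finset.HasAntidiagonal.antidiagonal n, n.choose ij.1 • (D^[ij.1] a * D^[ij.2] b) := by
  induction n with
  | zero => simp
  | succ n ih =>
    rw [Finset.sum_antidiagonal_choose_succ_nsmul (fun i j => D^[i] a * D^[j] b) n,
      Function.iterate_succ_apply', ih, map_sum, ← Finset.sum_add_distrib]
    refine Finset.sum_congr rfl fun ij hij => ?_
    rw [map_nsmul, D.leibniz, smul_eq_mul, smul_eq_mul, nsmul_add,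
      Nat.choose_symm_of_eq_add (Finset.HasAntidiagonal.mem_antidiagonal.1 hij).symm,
      Function.iterate_succ_apply', Function.iterate_succ_apply', mul_comm (D^[ij.2] b)]

/-- **Wronskian–Leibniz identity** used in the proof of Theorem 5.3.  For a derivation `D`
of a commutative ring `R` and all `a b ∈ R`, `m ≥ 1`:
`a·D^m(b) = D^{m−1}(a·D(b) − D(a)·b)
  + Σ_{s=1}^{m−1} (C(m−1,s) − C(m−1,s−1))·D^{m−s}(a)·D^{s}(b) + D^{m}(a)·b`. -/
theorem stmt_16 (R : Type*) [CommRing R] (D : Derivation ℤ R R) :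
    ∀ (a b : R) (m : ℕ), 1 ≤ m →
      a * (⇑D)^[m] b =
        (⇑D)^[m - 1] (a * D b - D a * b) +
          (∑ s ∈ Finset.Ico 1 m,
            (((m - 1).choose s : ℤ) - ((m - 1).choose (s - 1) : ℤ)) •
              ((⇑D)^[m - s] a * (⇑D)^[s] b)) +
          (⇑D)^[m] a * b := by
  intro a b m hm
  obtain ⟨n, rfl⟩ := Nat.exists_eq_add_of_le' hm
  have h_left : D^[n] (a * D b) =
      ∑ k ∈ Finset.range n, n.choose k • (D^[n - k] a * D^[k + 1] b) + a * D^[n + 1] b := by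
    rw [mul_comm, D.iterate_mul, Finset.Nat.sum_antidiagonal_eq_sum_range_succ_mk,
      Finset.sum_range_succ]
    simp [mul_comm]
  have h_right : D^[n] (D a * b) =
      ∑ k ∈ Finset.range n, n.choose (k + 1) • (D^[n - k] a * D^[k + 1] b) +
        D^[n + 1] a * b := by
    rw [mul_comm, D.iterate_mul, Finset.Nat.sum_antidiagonal_eq_sum_range_succ_mk,
      Finset.sum_range_succ']
    congr 1
    · refine Finset.sum_congr rfl fun k hk => ?_
      have hk' : n - k = n - (k + 1) + 1 := by have := Finset.mem_range.1 hk; omega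
      rw [hk', Function.iterate_succ_apply D (n - (k + 1)), mul_comm]
    · simp [mul_comm]
  have h_sum : ∑ s ∈ Finset.Ico 1 (n + 1), ((n.choose s : ℤ) - (n.choose (s - 1) : ℤ)) •
        (D^[n + 1 - s] a * D^[s] b) =
      ∑ k ∈ Finset.range n, n.choose (k + 1) • (D^[n - k] a * D^[k + 1] b) -
        ∑ k ∈ Finset.range n, n.choose k • (D^[n - k] a * D^[k + 1] b) := by
    rw [Finset.sum_Ico_eq_sum_range, ← Finset.sum_sub_distrib]
    refine Finset.sum_congr rfl fun k _ => ?_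
    rw [sub_smul, natCast_zsmul, natCast_zsmul, add_comm 1 k, Nat.add_sub_add_right,
      Nat.add_sub_cancel]
  rw [Nat.add_sub_cancel, iterate_map_sub, h_left, h_right, h_sum]
  ring
end
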